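/- arXiv:1611.01478 — 5 statements merged into one kernel-verified Lean document; each statement's English description precedes it below -/
import Mathlib

section
/- Let T be a unary-binary tree with n vertices, listed as v_1, ..., v_n in left-to-right breadth-first search order, and let N ⊆ {1, ..., n} be the set of indices i such that v_i has at least one child. A permutation σ of size n is valid for T (i.e., labeling v_i with σ_i for each i yields an increasing unary-binary tree and σ avoids 213) if and only if σ avoids 213 and for every i ∈ N, σ_i = min_{i ≤ j ≤ n} σ_j, i.e., every element of N is the index of a right-to-left minimum of σ. -/
/-- A sequence (list) avoids the pattern 213. -/
def Avoids213 (s : List ℕ) : Prop :=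
  ∀ i1 i2 i3, i1 < i2 → i2 < i3 → i3 < s.length →
    ¬ (s.getD i2 0 < s.getD i1 0 ∧ s.getD i1 0 < s.getD i3 0)
/-- Labeled unary-binary trees: each vertex carries a label and has 0, 1 or 2 children. -/
inductive UBTree where
  | lf : ℕ → UBTree
  | un : ℕ → UBTree → UBTree
  | bin : ℕ → UBTree → UBTree → UBTree

/-- Number of vertices. -/
def UBTree.size : UBTree → ℕ
  | .lf _ => 1
  | .un _ t => 1 + t.size
  | .bin _ l r => 1 + l.size + r.size

/-- Root label. -/
def UBTree.label : UBTree → ℕ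
  | .lf a => a
  | .un a _ => a
  | .bin a _ _ => a

/-- Ordered list of children (subtrees) of the root. -/
def UBTree.children : UBTree → List UBTree
  | .lf _ => []
  | .un _ t => [t]
  | .bin _ l r => [l, r]

/-- The labeling is increasing: every child has a larger label than its parent. -/
def UBTree.increasing : UBTree → Prop
  | .lf _ => True
  | .un a t => a < t.label ∧ t.increasing
  | .bin a l r => a < l.label ∧ a < r.label ∧ l.increasing ∧ r.increasing

/-- Number of unary nodes (vertices with exactly one child). -/
def UBTree.unaryCount : UBTree → ℕ
  | .lf _ => 0
  | .un _ t => 1 + t.unaryCount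
  | .bin _ l r => l.unaryCount + r.unaryCount

/-- Breadth-first traversal of a queue of trees, recording `f` at each vertex;
the fuel bounds the number of vertices processed. -/
def bfsAux (f : UBTree → ℕ) : ℕ → List UBTree → List ℕ
  | 0, _ => []
  | _ + 1, [] => []
  | n + 1, t :: ts => f t :: bfsAux f n (ts ++ t.children)

/-- Labels of the tree read in left-to-right breadth-first search order
(the fuel `t.size` is exactly the number of vertices, hence suffices). -/
def UBTree.bfs (t : UBTree) : List ℕ := bfsAux UBTree.label t.size [t]

/-- Arities (numbers of children) of the vertices read in left-to-right
breadth-first search order. -/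
def UBTree.bfsArity (t : UBTree) : List ℕ :=
  bfsAux (fun t => t.children.length) t.size [t]

/-- An increasing unary-binary tree (vertices labeled bijectively with `1, ..., n`,
children having larger labels than their parents) whose associated permutation
(labels in breadth-first search order) avoids the pattern 213. -/
def IsGoodUB (t : UBTree) : Prop :=
  t.increasing ∧ t.bfs.Perm (List.range' 1 t.size) ∧ Avoids213 t.bfs

theorem Avoids213.tail {a : ℕ} {s : List ℕ} (h : Avoids213 (a :: s)) : Avoids213 s := by
  intro i j k hij hjk hk
  simpa using h (i + 1) (j + 1) (k + 1) (by omega) (by omega) (by simpa using hk)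

theorem Avoids213.le_of_mem {a x y : ℕ} {s u : List ℕ} (h : Avoids213 (a :: (s ++ y :: u)))
    (hx : x ∈ s) (hy : a < y) : a ≤ x := by
  obtain ⟨k, hk, rfl⟩ := List.mem_iff_getElem.1 hx
  by_contra! hlt
  refine h 0 (k + 1) (s.length + 1) (by omega) (by omega) (by simp) ?_
  simpa [List.getElem?_append_left hk, hk] using ⟨hlt, hy⟩

theorem UBTree.increasing_iff (t : UBTree) :
    t.increasing ↔ ∀ c ∈ t.children, t.label < c.label ∧ c.increasing := by
  cases t <;> simp [UBTree.increasing, UBTree.children, UBTree.label]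
  tauto

theorem UBTree.size_eq (t : UBTree) : t.size = 1 + (t.children.map UBTree.size).sum := by
  cases t <;> simp [UBTree.size, UBTree.children]
  omega

theorem length_le_sum_size (q : List UBTree) : q.length ≤ (q.map UBTree.size).sum := by
  induction q with
  | nil => simp
  | cons t q ih =>
    have := t.size_eq
    simp only [List.length_cons, List.map_cons, List.sum_cons]
    omega

theorem sum_size_queue {t : UBTree} {q : List UBTree} {m : ℕ}
    (h : ((t :: q).map UBTree.size).sum ≤ m + 1) :
    ((q ++ t.children).map UBTree.size).sum ≤ m := by
  have := t.size_eq
  simp only [List.map_cons, List.sum_cons, List.map_append, List.sum_append] at *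
  omega

/-- The traversal starts by reading off the queue. -/
theorem exists_bfsAux_append (f : UBTree → ℕ) (q r : List UBTree) (m : ℕ) (h : q.length ≤ m) :
    ∃ s, bfsAux f m (q ++ r) = q.map f ++ s := by
  induction q generalizing r m with
  | nil => exact ⟨_, rfl⟩
  | cons t q ih =>
    obtain _ | m := m
    · simp at h
    obtain ⟨s, hs⟩ := ih (r ++ t.children) m (by simpa using h)
    exact ⟨s, by simp [bfsAux, hs]⟩

theorem mem_bfsAux (f : UBTree → ℕ) {q : List UBTree} {m : ℕ}
    (h : (q.map UBTree.size).sum ≤ m) {t : UBTree} (ht : t ∈ q) : f t ∈ bfsAux f m q := by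
  obtain ⟨s, hs⟩ := exists_bfsAux_append f q [] m ((length_le_sum_size q).trans h)
  rw [List.append_nil] at hs
  rw [hs]
  exact List.mem_append_left _ (List.mem_map_of_mem ht)

theorem le_of_mem_bfsAux_label {a : ℕ} (m : ℕ) (q : List UBTree) (hinc : ∀ t ∈ q, t.increasing)
    (ha : ∀ t ∈ q, a ≤ t.label) : ∀ x ∈ bfsAux UBTree.label m q, a ≤ x := by
  induction m generalizing q with
  | zero => simp [bfsAux]
  | succ m ih =>
    obtain _ | ⟨t, q⟩ := q
    · simp [bfsAux]
    have hc := t.increasing_iff.1 (hinc t (by simp))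
    have hta := ha t (by simp)
    intro x hx
    rcases List.mem_cons.1 hx with rfl | hx
    · exact hta
    · refine ih (q ++ t.children) (fun c h => ?_) (fun c h => ?_) x hx
      · rcases List.mem_append.1 h with h | h
        · exact hinc c (by simp [h])
        · exact (hc c h).2
      · rcases List.mem_append.1 h with h | h
        · exact ha c (by simp [h])
        · exact hta.trans (hc c h).1.le

theorem le_getD_of_increasing (m : ℕ) (q : List UBTree) (hinc : ∀ t ∈ q, t.increasing)
    (hm : (q.map UBTree.size).sum ≤ m) (hav : Avoids213 (bfsAux UBTree.label m q)) (i j : ℕ)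
    (hi : 1 ≤ (bfsAux (fun t => t.children.length) m q).getD i 0) (hij : i ≤ j)
    (hj : j < (bfsAux UBTree.label m q).length) :
    (bfsAux UBTree.label m q).getD i 0 ≤ (bfsAux UBTree.label m q).getD j 0 := by
  induction m generalizing q i j with
  | zero => simp [bfsAux] at hj
  | succ m ih =>
    obtain _ | ⟨t, q⟩ := q
    · simp [bfsAux] at hj
    have hc := t.increasing_iff.1 (hinc t (by simp))
    have hm' := sum_size_queue hm
    have hinc' : ∀ c ∈ q ++ t.children, c.increasing := by
      intro c h
      rcases List.mem_append.1 h with h | h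
      · exact hinc c (by simp [h])
      · exact (hc c h).2
    simp only [bfsAux] at hav hi hj ⊢
    obtain _ | j := j
    · obtain rfl : i = 0 := by omega
      exact le_rfl
    simp only [List.length_cons, Nat.add_lt_add_iff_right] at hj
    obtain _ | i := i
    · simp only [List.getD_cons_zero, List.getD_cons_succ] at hi ⊢
      obtain ⟨c, cs, hcs⟩ := List.exists_cons_of_length_pos hi
      obtain ⟨s, hs⟩ := exists_bfsAux_append UBTree.label (q ++ t.children) [] m
        ((length_le_sum_size _).trans hm')
      rw [List.getD_eq_getElem _ _ hj]
      refine le_of_mem_bfsAux_label m _ hinc' (fun x hx => ?_) _ (List.getElem_mem hj)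
      rcases List.mem_append.1 hx with hx | hx
      · rw [List.append_nil] at hs
        rw [hs, hcs, List.map_append, List.map_cons, List.append_assoc, List.cons_append] at hav
        exact hav.le_of_mem (List.mem_map_of_mem hx) (hc c (by simp [hcs])).1
      · exact (hc x hx).1.le
    · simp only [List.getD_cons_succ] at hi ⊢
      exact ih _ hinc' hm' hav.tail i j hi (by omega) hj

theorem increasing_of_le_getD (m : ℕ) (q : List UBTree)
    (hm : (q.map UBTree.size).sum ≤ m) (hnd : (bfsAux UBTree.label m q).Nodup)
    (hmin : ∀ i j, 1 ≤ (bfsAux (fun t => t.children.length) m q).getD i 0 → i ≤ j →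
      j < (bfsAux UBTree.label m q).length →
      (bfsAux UBTree.label m q).getD i 0 ≤ (bfsAux UBTree.label m q).getD j 0) :
    ∀ t ∈ q, t.increasing := by
  induction m generalizing q with
  | zero =>
    have := (length_le_sum_size q).trans hm
    simp_all
  | succ m ih =>
    obtain _ | ⟨t, q⟩ := q
    · simp
    have hm' := sum_size_queue hm
    simp only [bfsAux] at hnd hmin
    obtain ⟨hne, hnd'⟩ := List.nodup_cons.1 hnd
    have hinc := ih _ hm' hnd' fun i j hi hij hj => by
      simpa using hmin (i + 1) (j + 1) (by simpa using hi) (by omega) (by simpa using hj)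
    refine List.forall_mem_cons.2 ⟨t.increasing_iff.2 fun c hc => ?_,
      fun c hc => hinc c (List.mem_append_left _ hc)⟩
    refine ⟨?_, hinc c (List.mem_append_right _ hc)⟩
    have hmem := mem_bfsAux UBTree.label hm' (List.mem_append_right q hc)
    refine lt_of_le_of_ne ?_ fun h => hne (h ▸ hmem)
    obtain ⟨k, hk, hkc⟩ := List.mem_iff_getElem.1 hmem
    have := hmin 0 (k + 1) (List.length_pos_of_mem hc) (by omega) (by simpa using hk)
    simpa [List.getD_eq_getElem _ _ hk, hk, hkc] using this

/-- A permutation (read as the BFS label sequence of a labeled unary-binary tree) is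
valid (the labeled tree is increasing and the permutation avoids 213) if and only if
it avoids 213 and every BFS-index of a node is the index of a right-to-left minimum. -/
theorem stmt10 (t : UBTree) (n : ℕ) (hn : n = t.size)
    (hperm : t.bfs.Perm (List.range' 1 n)) :
    (t.increasing ∧ Avoids213 t.bfs) ↔
      (Avoids213 t.bfs ∧ ∀ i, i < n → 1 ≤ t.bfsArity.getD i 0 →
        ∀ j, i ≤ j → j < n → t.bfs.getD i 0 ≤ t.bfs.getD j 0) := by
  have hlen : t.bfs.length = n := by simpa using hperm.length_eq
  constructor
  · rintro ⟨hinc, hav⟩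
    refine ⟨hav, fun i _ hi j hij hj => ?_⟩
    exact le_getD_of_increasing t.size [t] (by simpa using hinc) (by simp) hav i j hi hij
      (hj.trans_eq hlen.symm)
  · rintro ⟨hav, hmin⟩
    refine ⟨?_, hav⟩
    refine increasing_of_le_getD t.size [t] (by simp) (hperm.nodup_iff.2 List.nodup_range')
      (fun i j hi hij hj => ?_) t (by simp)
    have hjn : j < n := hj.trans_eq hlen
    exact hmin i (hij.trans_lt hjn) hi j hij hjn
end

section
/- For every integer n ≥ 1, the (n-1)-st Catalan number is equal to the number of increasing unary-binary trees with n vertices whose associated permutation avoids 213 and that satisfy the following property: if ℓ_1, ..., ℓ_k denote the leaves read after the last node in left-to-right breadth-first search order, then the last leaf ℓ_k has the smallest label among the labels of ℓ_1, ..., ℓ_k. -/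
/-- The property that, among the leaves read after the last node in breadth-first
search order, the last leaf has the smallest label: for every BFS-index `j` such that
all vertices from position `j` on are leaves, the last label is at most the label at `j`. -/
def LastLeafProp (t : UBTree) : Prop :=
  ∀ j, j < t.size → (∀ m, j ≤ m → m < t.size → t.bfsArity.getD m 0 = 0) →
    t.bfs.getD (t.size - 1) 0 ≤ t.bfs.getD j 0

namespace UBTree

/-- Apply `f` to all the labels of a tree. -/
def map (f : ℕ → ℕ) : UBTree → UBTree
  | .lf a => .lf (f a)
  | .un a t => .un (f a) (t.map f)
  | .bin a l r => .bin (f a) (l.map f) (r.map f)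

@[simp] lemma size_map (f : ℕ → ℕ) (t : UBTree) : (t.map f).size = t.size := by
  induction t <;> simp_all [map, size]

@[simp] lemma label_map (f : ℕ → ℕ) (t : UBTree) : (t.map f).label = f t.label := by
  cases t <;> simp [map, label]

@[simp] lemma children_map (f : ℕ → ℕ) (t : UBTree) :
    (t.map f).children = t.children.map (map f) := by
  cases t <;> simp [map, children]

lemma map_map (f g : ℕ → ℕ) (t : UBTree) : (t.map f).map g = t.map (g ∘ f) := by
  induction t <;> simp_all [map]

lemma map_id' (t : UBTree) : t.map id = t := by
  induction t <;> simp_all [map]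

lemma increasing_map {f : ℕ → ℕ} (hf : StrictMono f) (t : UBTree) :
    (t.map f).increasing ↔ t.increasing := by
  induction t <;> simp_all [map, increasing, hf.lt_iff_lt]

lemma increasing_iff_s13 (t : UBTree) :
    t.increasing ↔ (∀ c ∈ t.children, t.label < c.label) ∧ ∀ c ∈ t.children, c.increasing := by
  cases t <;> simp [increasing, children, label]
  tauto

lemma ext_label_children {s t : UBTree} (h : s.label = t.label) (h' : s.children = t.children) :
    s = t := by
  cases s <;> cases t <;> simp_all [label, children]

end UBTree

/-- Number of vertices of a forest. -/
def forestSize (Q : List UBTree) : ℕ := (Q.map UBTree.size).sum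

/-- Breadth-first traversal of a forest. -/
def forestBfs (f : UBTree → ℕ) (Q : List UBTree) : List ℕ := bfsAux f (forestSize Q) Q

@[simp] lemma forestSize_nil : forestSize [] = 0 := rfl

lemma forestSize_cons (t : UBTree) (ts : List UBTree) :
    forestSize (t :: ts) = forestSize (ts ++ t.children) + 1 := by
  cases t <;> simp [forestSize, UBTree.size, UBTree.children] <;> omega

@[simp] lemma forestSize_map (f : ℕ → ℕ) (Q : List UBTree) :
    forestSize (Q.map (UBTree.map f)) = forestSize Q := by
  simp [forestSize, Function.comp_def]

lemma forestSize_eq_zero {Q : List UBTree} : forestSize Q = 0 ↔ Q = [] := by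
  cases Q with
  | nil => simp
  | cons t ts => simp [forestSize_cons]

@[simp] lemma forestBfs_nil (f : UBTree → ℕ) : forestBfs f [] = [] := rfl

lemma forestBfs_cons (f : UBTree → ℕ) (t : UBTree) (ts : List UBTree) :
    forestBfs f (t :: ts) = f t :: forestBfs f (ts ++ t.children) := by
  rw [forestBfs, forestSize_cons]
  rfl

/-- Induction along the breadth-first traversal of a forest. -/
lemma forest_induction {P : List UBTree → Prop} (nil : P [])
    (cons : ∀ t ts, P (ts ++ t.children) → P (t :: ts)) (Q : List UBTree) : P Q := by
  induction h : forestSize Q using Nat.strong_induction_on generalizing Q with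
  | _ n ih =>
    cases Q with
    | nil => exact nil
    | cons t ts =>
      have := forestSize_cons t ts
      exact cons t ts (ih _ (by omega) _ rfl)

@[simp] lemma length_forestBfs (f : UBTree → ℕ) (Q : List UBTree) :
    (forestBfs f Q).length = forestSize Q := by
  induction Q using forest_induction with
  | nil => rfl
  | cons t ts ih => simp [forestBfs_cons, forestSize_cons, ih]

lemma forestBfs_label_map (f : ℕ → ℕ) (Q : List UBTree) :
    forestBfs UBTree.label (Q.map (UBTree.map f)) = (forestBfs UBTree.label Q).map f := by
  induction Q using forest_induction with
  | nil => rfl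
  | cons t ts ih => simpa [forestBfs_cons] using ih

lemma forest_map_eq_self {f : ℕ → ℕ} (Q : List UBTree)
    (h : ∀ x ∈ forestBfs UBTree.label Q, f x = x) : Q.map (UBTree.map f) = Q := by
  induction Q using forest_induction with
  | nil => rfl
  | cons t ts ih =>
    simp only [forestBfs_cons, List.mem_cons, forall_eq_or_imp] at h
    have := ih h.2
    rw [List.map_append] at this
    obtain ⟨h1, h2⟩ := List.append_inj this (by simp)
    rw [List.map_cons, h1]
    congr 1
    exact UBTree.ext_label_children (by simp [h.1]) (by simpa using h2)

/-- The labels of the roots form a prefix of the breadth-first word. -/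
lemma forestBfs_prefix (f : UBTree → ℕ) (Q : List UBTree) : Q.map f <+: forestBfs f Q := by
  induction Q using forest_induction with
  | nil => simp
  | cons t ts ih =>
    rw [forestBfs_cons, List.map_cons, List.cons_prefix_cons]
    exact ⟨rfl, ((List.prefix_append _ _).map f).trans ih⟩

/-- In an increasing forest, every label is bounded below by the label of some root. -/
lemma exists_root_label_le {Q : List UBTree} (hQ : ∀ t ∈ Q, t.increasing) {x : ℕ}
    (hx : x ∈ forestBfs UBTree.label Q) : ∃ t ∈ Q, t.label ≤ x := by
  induction Q using forest_induction with
  | nil => simp at hx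
  | cons t ts ih =>
    simp only [forestBfs_cons, List.mem_cons] at hx
    obtain rfl | hx := hx
    · exact ⟨t, by simp⟩
    · have ht := (UBTree.increasing_iff_s13 t).1 (hQ t (by simp))
      obtain ⟨s, hs, hsx⟩ := ih (by
        intro s hs
        rcases List.mem_append.1 hs with hs | hs
        · exact hQ s (by simp [hs])
        · exact ht.2 s hs) hx
      rcases List.mem_append.1 hs with hs | hs
      · exact ⟨s, by simp [hs], hsx⟩
      · exact ⟨t, by simp, (ht.1 s hs).le.trans hsx⟩

/-- All the trees of the forest are single vertices. -/
def AllLeaves (Q : List UBTree) : Prop := ∀ t ∈ Q, t.children = []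

lemma allLeaves_map (f : ℕ → ℕ) (Q : List UBTree) :
    AllLeaves (Q.map (UBTree.map f)) ↔ AllLeaves Q := by
  simp [AllLeaves]

lemma forall_mem_arity_eq_zero (Q : List UBTree) :
    (∀ a ∈ forestBfs (fun t => t.children.length) Q, a = 0) ↔ AllLeaves Q := by
  induction Q using forest_induction with
  | nil => simp [AllLeaves]
  | cons t ts ih =>
    simp only [forestBfs_cons, List.mem_cons, forall_eq_or_imp, ih, List.length_eq_zero_iff,
      AllLeaves, List.mem_append]
    refine and_congr_right fun h => ?_
    simp [h]

/-- Make room for the value `v`: all values at least `v` are increased by one. -/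
def shiftUp (v x : ℕ) : ℕ := if v ≤ x then x + 1 else x

/-- Close the gap at the value `v`: all values above `v` are decreased by one. -/
def shiftDown (v x : ℕ) : ℕ := if v < x then x - 1 else x

lemma shiftUp_strictMono (v : ℕ) : StrictMono (shiftUp v) := by
  intro x y h
  unfold shiftUp
  split_ifs <;> omega

lemma shiftDown_shiftUp (v x : ℕ) : shiftDown v (shiftUp v x) = x := by
  unfold shiftDown shiftUp
  split_ifs <;> omega

lemma shiftUp_shiftDown {v x : ℕ} (h : x ≠ v) : shiftUp v (shiftDown v x) = x := by
  unfold shiftDown shiftUp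
  split_ifs <;> omega

lemma shiftUp_ne (v x : ℕ) : shiftUp v x ≠ v := by
  unfold shiftUp
  split_ifs <;> omega

lemma shiftUp_lt_iff {v w x : ℕ} (h : w ≤ v) : shiftUp v x < w ↔ x < w := by
  unfold shiftUp
  split_ifs <;> omega

lemma lt_shiftUp_iff {v x : ℕ} : v < shiftUp v x ↔ v ≤ x := by
  unfold shiftUp
  split_ifs <;> omega

lemma map_shiftUp_map_shiftDown (v : ℕ) (Q : List UBTree) :
    (Q.map (UBTree.map (shiftUp v))).map (UBTree.map (shiftDown v)) = Q := by
  rw [List.map_map]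
  refine (List.map_congr_left fun t _ => ?_).trans (List.map_id Q)
  have : shiftDown v ∘ shiftUp v = id := funext (shiftDown_shiftUp v)
  rw [Function.comp_apply, UBTree.map_map, this, UBTree.map_id', id]

lemma map_shiftDown_map_shiftUp {v : ℕ} {Q : List UBTree}
    (h : v ∉ forestBfs UBTree.label Q) :
    (Q.map (UBTree.map (shiftDown v))).map (UBTree.map (shiftUp v)) = Q := by
  rw [List.map_map]
  have : (UBTree.map (shiftUp v) ∘ UBTree.map (shiftDown v)) =
      UBTree.map (shiftUp v ∘ shiftDown v) := funext fun t => UBTree.map_map _ _ t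
  rw [this]
  exact forest_map_eq_self Q fun x hx => shiftUp_shiftDown (by rintro rfl; exact h hx)

/-- All the entries of `s` that are at least `v` come before those that are less than `v`. -/
def IsCut (s : List ℕ) (v : ℕ) : Prop := s.Pairwise fun x y => x < v → y < v

lemma avoids213_nil : Avoids213 [] := by
  intro i j k _ _ h
  simp at h

lemma avoids213_cons (v : ℕ) (s : List ℕ) :
    Avoids213 (v :: s) ↔ s.Pairwise (fun x y => x < v → ¬ v < y) ∧ Avoids213 s := by
  constructor
  · intro h
    constructor
    · rw [List.pairwise_iff_getElem]
      intro i j hi hj hij h1 h2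
      have := h 0 (i + 1) (j + 1) (by omega) (by omega) (by simpa)
      simp [hi, hj] at this
      omega
    · intro i j k hij hjk hk
      simpa using h (i + 1) (j + 1) (k + 1) (by omega) (by omega) (by simpa)
  · rintro ⟨h, h'⟩ i j k hij hjk hk
    obtain ⟨j, rfl⟩ : ∃ j', j = j' + 1 := ⟨j - 1, by omega⟩
    obtain ⟨k, rfl⟩ : ∃ k', k = k' + 1 := ⟨k - 1, by omega⟩
    simp only [List.length_cons, add_lt_add_iff_right] at hk
    cases i with
    | zero =>
      rw [List.pairwise_iff_getElem] at h
      have := h j k (by omega) hk (by omega)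
      have hj : j < s.length := by omega
      simp [hj, hk]
      omega
    | succ i => simpa using h' i j k (by omega) (by omega) hk

lemma avoids213_map {f : ℕ → ℕ} (hf : StrictMono f) (s : List ℕ) :
    Avoids213 (s.map f) ↔ Avoids213 s := by
  induction s with
  | nil => simp
  | cons v s ih => simp [avoids213_cons, ih, List.pairwise_map, hf.lt_iff_lt, hf.le_iff_le]

lemma avoids213_cons_shiftUp (v : ℕ) (s : List ℕ) :
    Avoids213 (v :: s.map (shiftUp v)) ↔ IsCut s v ∧ Avoids213 s := by
  rw [avoids213_cons, avoids213_map (shiftUp_strictMono v), List.pairwise_map]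
  simp only [shiftUp_lt_iff le_rfl, lt_shiftUp_iff, not_le, IsCut]

lemma perm_range'_iff {s : List ℕ} {k : ℕ} :
    s.Perm (List.range' 1 k) ↔ s.Nodup ∧ ∀ x, x ∈ s ↔ 1 ≤ x ∧ x ≤ k := by
  constructor
  · intro h
    refine ⟨h.nodup_iff.2 List.nodup_range', fun x => ?_⟩
    rw [h.mem_iff, List.mem_range'_1]
    omega
  · rintro ⟨h, h'⟩
    rw [List.perm_ext_iff_of_nodup h List.nodup_range']
    intro x
    rw [h', List.mem_range'_1]
    omega

lemma cons_shiftUp_perm_iff {v k : ℕ} (s : List ℕ) (hv : 1 ≤ v) (hvk : v ≤ k + 1) :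
    (v :: s.map (shiftUp v)).Perm (List.range' 1 (k + 1)) ↔ s.Perm (List.range' 1 k) := by
  rw [perm_range'_iff, perm_range'_iff, List.nodup_cons,
    List.nodup_map_iff (shiftUp_strictMono v).injective]
  have h1 : v ∉ s.map (shiftUp v) := by simp [shiftUp_ne]
  simp only [h1, not_false_eq_true, true_and]
  refine and_congr_right fun _ => ⟨fun h x => ?_, fun h x => ?_⟩
  · rw [← List.mem_map_of_injective (shiftUp_strictMono v).injective]
    have := h (shiftUp v x)
    simp only [List.mem_cons, shiftUp_ne, false_or] at this
    rw [this]
    unfold shiftUp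
    split_ifs <;> omega
  · by_cases hx : x = v
    · simp only [hx, List.mem_cons, true_or, true_iff]
      omega
    · rw [← shiftUp_shiftDown hx, List.mem_cons,
        List.mem_map_of_injective (shiftUp_strictMono v).injective, h, shiftUp_shiftDown hx]
      unfold shiftDown
      split_ifs <;> omega

/-- The cut values of a word on `1, ..., k`. -/
noncomputable def cuts (s : List ℕ) : Finset ℕ :=
  open Classical in (Finset.Icc 1 (s.length + 1)).filter (IsCut s)

lemma mem_cuts {s : List ℕ} {v : ℕ} :
    v ∈ cuts s ↔ (1 ≤ v ∧ v ≤ s.length + 1) ∧ IsCut s v := by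
  simp [cuts]

lemma cuts_cons_shiftUp {s : List ℕ} (hs : s.Perm (List.range' 1 s.length)) {v : ℕ}
    (hv : v ∈ cuts s) :
    cuts (v :: s.map (shiftUp v)) = insert (s.length + 2) {w ∈ cuts s | w ≤ v} := by
  rw [mem_cuts] at hv
  have hmem := (perm_range'_iff.1 ((cons_shiftUp_perm_iff s hv.1.1 hv.1.2).2 hs)).2
  ext w
  simp only [Finset.mem_insert, Finset.mem_filter, mem_cuts, List.length_cons, List.length_map]
  by_cases hwv : w ≤ v
  · have : IsCut (v :: s.map (shiftUp v)) w ↔ IsCut s w := by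
      rw [IsCut, List.pairwise_cons, List.pairwise_map]
      simp only [shiftUp_lt_iff hwv, not_lt.2 hwv, IsCut]
      simp
    rw [this]
    refine ⟨fun h => Or.inr ⟨⟨⟨h.1.1, by omega⟩, h.2⟩, hwv⟩, ?_⟩
    rintro (h | h)
    · omega
    · exact ⟨⟨h.1.1.1, by omega⟩, h.1.2⟩
  · have : w ≤ s.length + 2 → (IsCut (v :: s.map (shiftUp v)) w ↔ w = s.length + 2) := by
      intro hw
      constructor
      · intro h
        rw [IsCut, List.pairwise_cons] at h
        by_contra hne
        have h1 := (hmem w).2 (by omega)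
        rw [List.mem_cons] at h1
        have := h.1 w (h1.resolve_left (by omega)) (by omega)
        omega
      · rintro rfl
        refine List.pairwise_of_forall_mem_list fun x _ y hy _ => ?_
        have := (hmem y).1 hy
        omega
    constructor
    · rintro ⟨h1, h2⟩
      exact Or.inl ((this (by omega)).1 h2)
    · rintro (h | h)
      · exact ⟨by omega, (this (by omega)).2 h⟩
      · omega

lemma card_cuts_cons_shiftUp {s : List ℕ} (hs : s.Perm (List.range' 1 s.length)) {v : ℕ}
    (hv : v ∈ cuts s) :
    (cuts (v :: s.map (shiftUp v))).card = {w ∈ cuts s | w ≤ v}.card + 1 := by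
  rw [cuts_cons_shiftUp hs hv, Finset.card_insert_of_notMem]
  simp only [Finset.mem_filter, mem_cuts]
  omega

lemma one_mem_cuts {s : List ℕ} (hs : s.Perm (List.range' 1 s.length)) : 1 ∈ cuts s := by
  refine mem_cuts.2 ⟨by omega, List.pairwise_of_forall_mem_list fun x hx y _ h => ?_⟩
  have := (perm_range'_iff.1 hs).2 x
  grind

lemma filter_cuts_le_one {s : List ℕ} (hs : s.Perm (List.range' 1 s.length)) :
    {w ∈ cuts s | w ≤ 1} = {1} := by
  ext w
  have := one_mem_cuts hs
  simp only [Finset.mem_filter, Finset.mem_singleton]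
  constructor
  · rintro ⟨h, _⟩
    rw [mem_cuts] at h
    omega
  · rintro rfl
    exact ⟨this, le_rfl⟩

/-- Summing over a finite set a function of the rank of its elements. -/
lemma sum_rank {M : Type*} [AddCommMonoid M] (g : ℕ → M) (S : Finset ℕ) :
    ∑ v ∈ S, g {w ∈ S | w ≤ v}.card = ∑ j ∈ Finset.range S.card, g (j + 1) := by
  induction S using Finset.induction_on_max with
  | empty => simp
  | insert a s h ih =>
    have ha : a ∉ s := fun h' => lt_irrefl _ (h a h')
    rw [Finset.sum_insert ha, Finset.card_insert_of_notMem ha, Finset.sum_range_succ, ← ih,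
      add_comm]
    congr 1
    · refine Finset.sum_congr rfl fun v hv => ?_
      congr 2
      rw [Finset.filter_insert, if_neg (not_le.2 (h v hv))]
    · congr 1
      rw [Finset.filter_true_of_mem, Finset.card_insert_of_notMem ha]
      intro x hx
      rcases Finset.mem_insert.1 hx with rfl | hx
      · exact le_rfl
      · exact (h x hx).le

/-- Among the entries of `B` from which on `A` vanishes, the last one is the smallest. -/
def LastMin (A B : List ℕ) : Prop :=
  ∀ j, j < B.length → (∀ m, j ≤ m → m < B.length → A.getD m 0 = 0) →
    B.getD (B.length - 1) 0 ≤ B.getD j 0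

lemma lastMin_cons {A B : List ℕ} (hAB : A.length = B.length) (a b : ℕ) :
    LastMin (a :: A) (b :: B) ↔
      LastMin A B ∧ (a = 0 → (∀ x ∈ A, x = 0) → ∀ y ∈ B.getLast?, y ≤ b) := by
  have hall : (∀ x ∈ A, x = 0) ↔ ∀ m < B.length, A.getD m 0 = 0 := by
    rw [List.forall_mem_iff_getElem, ← hAB]
    refine forall₂_congr fun m hm => ?_
    simp [hm]
  have hlast : ∀ c, (∀ y ∈ B.getLast?, y ≤ c) ↔ (0 < B.length → B.getD (B.length - 1) 0 ≤ c) := by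
    intro c
    rcases B.eq_nil_or_concat with rfl | ⟨B, y, rfl⟩
    · simp
    · simp
  rw [hall, hlast]
  constructor
  · intro h
    refine ⟨fun j hj hA => ?_, fun ha hA hB => ?_⟩
    · have := h (j + 1) (by simpa) fun m hm hm' => by
        obtain ⟨m, rfl⟩ : ∃ m', m = m' + 1 := ⟨m - 1, by omega⟩
        simpa using hA m (by omega) (by simpa using hm')
      obtain ⟨n, hn⟩ : ∃ n, B.length = n + 1 := ⟨B.length - 1, by omega⟩
      simpa [hn] using this
    · have := h 0 (by simp) fun m _ hm' => by
        cases m with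
        | zero => simpa
        | succ m => simpa using hA m (by simpa using hm')
      obtain ⟨n, hn⟩ : ∃ n, B.length = n + 1 := ⟨B.length - 1, by omega⟩
      simpa [hn] using this
  · rintro ⟨h, h'⟩ j hj hA
    rcases Nat.eq_zero_or_pos B.length with hB | hB
    · rw [List.length_eq_zero_iff] at hB
      subst hB
      obtain rfl : j = 0 := by simpa using hj
      simp
    obtain ⟨n, hn⟩ : ∃ n, B.length = n + 1 := ⟨B.length - 1, by omega⟩
    cases j with
    | zero =>
      have := h' (by simpa using hA 0 le_rfl (by simp))
        (fun m hm => by simpa using hA (m + 1) (by omega) (by simpa)) hB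
      simpa [hn] using this
    | succ j =>
      have := h j (by simpa using hj) fun m hm hm' => by
        simpa using hA (m + 1) (by omega) (by simpa)
      simpa [hn] using this

lemma lastMin_map {f : ℕ → ℕ} (hf : StrictMono f) (A B : List ℕ) :
    LastMin A (B.map f) ↔ LastMin A B := by
  simp only [LastMin, List.length_map]
  refine forall₂_congr fun j hj => ?_
  have : B.length - 1 < B.length := by omega
  simp [hj, this, hf.le_iff_le]

/-- The forests of pending subtrees occurring in the breadth-first traversal of the
trees to be counted, with standardized labels. -/
structure IsGoodForest (Q : List UBTree) : Prop where
  increasing : ∀ t ∈ Q, t.increasing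
  perm : (forestBfs UBTree.label Q).Perm (List.range' 1 (forestSize Q))
  avoids : Avoids213 (forestBfs UBTree.label Q)
  lastMin : LastMin (forestBfs (fun t => t.children.length) Q) (forestBfs UBTree.label Q)

lemma forestBfs_arity_map (f : ℕ → ℕ) (Q : List UBTree) :
    forestBfs (fun t => t.children.length) (Q.map (UBTree.map f)) =
      forestBfs (fun t => t.children.length) Q := by
  induction Q using forest_induction with
  | nil => rfl
  | cons t ts ih => simpa [forestBfs_cons] using ih

lemma isGoodForest_singleton (t : UBTree) :
    IsGoodForest [t] ↔ IsGoodUB t ∧ LastLeafProp t := by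
  have hs : forestSize [t] = t.size := by simp [forestSize]
  have h1 : forestBfs UBTree.label [t] = t.bfs := by rw [forestBfs, hs]; rfl
  have h2 : forestBfs (fun t => t.children.length) [t] = t.bfsArity := by
    rw [forestBfs, hs]; rfl
  have h3 : t.bfs.length = t.size := by rw [← h1, length_forestBfs, hs]
  constructor
  · rintro ⟨a, b, c, d⟩
    rw [h1] at b c d
    rw [h2, LastMin, h3] at d
    rw [hs] at b
    exact ⟨⟨a t (by simp), b, c⟩, d⟩
  · rintro ⟨⟨a, b, c⟩, d⟩
    refine ⟨by simpa, ?_, ?_, ?_⟩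
    · rwa [h1, hs]
    · rwa [h1]
    · rwa [h1, h2, LastMin, h3]

/-- Adding a vertex in front of a forest. -/
lemma isGoodForest_cons_iff {Q ts : List UBTree} {t : UBTree}
    (hv : 1 ≤ t.label) (hv' : t.label ≤ forestSize Q + 1)
    (h : ts ++ t.children = Q.map (UBTree.map (shiftUp t.label))) :
    IsGoodForest (t :: ts) ↔ IsGoodForest Q ∧
      IsCut (forestBfs UBTree.label Q) t.label ∧ (∀ c ∈ t.children, t.label < c.label) ∧
      (AllLeaves (t :: ts) →
        ∀ y ∈ ((forestBfs UBTree.label Q).map (shiftUp t.label)).getLast?, y ≤ t.label) := by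
  have hmono := shiftUp_strictMono t.label
  have e1 : forestBfs UBTree.label (t :: ts) =
      t.label :: (forestBfs UBTree.label Q).map (shiftUp t.label) := by
    rw [forestBfs_cons, h, forestBfs_label_map]
  have e2 : forestBfs (fun t => t.children.length) (t :: ts) =
      t.children.length :: forestBfs (fun t => t.children.length) Q := by
    rw [forestBfs_cons, h, forestBfs_arity_map]
  have e3 : forestSize (t :: ts) = forestSize Q + 1 := by
    rw [forestSize_cons, h, forestSize_map]
  have e4 : AllLeaves (t :: ts) ↔ t.children.length = 0 ∧ AllLeaves Q := by
    rw [← forall_mem_arity_eq_zero, ← forall_mem_arity_eq_zero, e2]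
    simp
  have e5 : (∀ s ∈ t :: ts, s.increasing) ↔
      (∀ c ∈ t.children, t.label < c.label) ∧ ∀ s ∈ Q, s.increasing := by
    have : (∀ s ∈ Q, s.increasing) ↔ ∀ s ∈ ts ++ t.children, s.increasing := by
      simp [h, UBTree.increasing_map hmono]
    rw [this, List.forall_mem_cons, UBTree.increasing_iff_s13, List.forall_mem_append]
    tauto
  have e6 := lastMin_cons (A := forestBfs (fun t => t.children.length) Q)
    (B := (forestBfs UBTree.label Q).map (shiftUp t.label)) (by simp) t.children.length t.label
  rw [lastMin_map hmono, forall_mem_arity_eq_zero, ← and_imp, ← e4, ← e1, ← e2] at e6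
  have e7 := cons_shiftUp_perm_iff (forestBfs UBTree.label Q) hv hv'
  have e8 := avoids213_cons_shiftUp t.label (forestBfs UBTree.label Q)
  rw [← e1] at e7 e8
  rw [← e3] at e7
  constructor
  · rintro ⟨a, b, c, d⟩
    rw [e5] at a
    rw [e6] at d
    rw [e7] at b
    rw [e8] at c
    exact ⟨⟨a.2, b, c.2, d.1⟩, c.1, a.1, d.2⟩
  · rintro ⟨⟨a, b, c, d⟩, c', a', d'⟩
    exact ⟨e5.2 ⟨a', a⟩, e7.2 b, e8.2 ⟨c', c⟩, e6.2 ⟨d, d'⟩⟩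

/-- The standardized forest obtained by removing the first vertex. -/
def forestTail : List UBTree → List UBTree
  | [] => []
  | t :: ts => (ts ++ t.children).map (UBTree.map (shiftDown t.label))

lemma IsGoodForest.label_bounds {t : UBTree} {ts : List UBTree} (h : IsGoodForest (t :: ts)) :
    1 ≤ t.label ∧ t.label ≤ forestSize (t :: ts) :=
  ((perm_range'_iff.1 h.perm).2 t.label).1 (by simp [forestBfs_cons])

lemma forestTail_eq_iff {Q ts : List UBTree} {t : UBTree} (h : IsGoodForest (t :: ts)) :
    forestTail (t :: ts) = Q ↔ ts ++ t.children = Q.map (UBTree.map (shiftUp t.label)) := by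
  constructor
  · rintro rfl
    have := (perm_range'_iff.1 h.perm).1
    rw [forestBfs_cons, List.nodup_cons] at this
    exact (map_shiftDown_map_shiftUp this.1).symm
  · intro h
    rw [forestTail, h, map_shiftUp_map_shiftDown]

lemma forestSize_forestTail (t : UBTree) (ts : List UBTree) :
    forestSize (forestTail (t :: ts)) + 1 = forestSize (t :: ts) := by
  rw [forestSize_cons, forestTail, forestSize_map]

lemma IsGoodForest.tail {Q : List UBTree} (h : IsGoodForest Q) (hQ : Q ≠ []) :
    IsGoodForest (forestTail Q) := by
  cases Q with
  | nil => exact absurd rfl hQ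
  | cons t ts =>
    have hb := h.label_bounds
    have hs := forestSize_forestTail t ts
    exact ((isGoodForest_cons_iff hb.1 (by omega) ((forestTail_eq_iff h).1 rfl)).1 h).1

/-- A cut value not exceeding the label of the last root is equal to one. -/
lemma IsGoodForest.eq_one_of_isCut {ts : List UBTree} {t : UBTree}
    (h : IsGoodForest (ts ++ [t])) {v : ℕ} (hv : 1 ≤ v) (hvt : v ≤ t.label)
    (hc : IsCut (forestBfs UBTree.label (ts ++ [t])) v) : v = 1 := by
  by_contra hne
  have hmem := (perm_range'_iff.1 h.perm).2 1
  obtain ⟨s, hs, hs1⟩ := exists_root_label_le h.increasing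
    (hmem.2 ⟨le_rfl, Nat.one_le_iff_ne_zero.2 (by simp [forestSize_eq_zero])⟩)
  have hc' := List.Pairwise.sublist (forestBfs_prefix _ _).sublist hc
  rw [List.map_append, List.pairwise_append] at hc'
  rcases List.mem_append.1 hs with hs | hs
  · have := hc'.2.2 _ (List.mem_map_of_mem hs) t.label (by simp) (by omega)
    omega
  · rw [List.mem_singleton] at hs
    subst hs
    omega

lemma IsGoodForest.one_le_label {Q : List UBTree} (h : IsGoodForest Q) {t : UBTree}
    (ht : t ∈ Q) : 1 ≤ t.label :=
  (((perm_range'_iff.1 h.perm).2 t.label).1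
    ((forestBfs_prefix _ _).subset (List.mem_map_of_mem ht))).1

/-- In a good forest reduced to leaves, the last label is one. -/
lemma IsGoodForest.getLast?_of_allLeaves {Q : List UBTree} (h : IsGoodForest Q) (hQ : Q ≠ [])
    (hl : AllLeaves Q) : (forestBfs UBTree.label Q).getLast? = some 1 := by
  have hs : 0 < forestSize Q := Nat.pos_of_ne_zero fun h => hQ (forestSize_eq_zero.1 h)
  have hp := (perm_range'_iff.1 h.perm).2
  obtain ⟨j, hj, hj1⟩ := List.getElem_of_mem ((hp 1).2 ⟨le_rfl, hs⟩)
  have h0 := (forall_mem_arity_eq_zero Q).2 hl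
  have := h.lastMin j hj fun m _ hm => by
    rw [length_forestBfs] at hm
    rw [List.getD_eq_getElem _ _ (by simpa)]
    exact h0 _ (List.getElem_mem _)
  have hlt : (forestBfs UBTree.label Q).length - 1 < (forestBfs UBTree.label Q).length := by
    rw [length_forestBfs]; omega
  rw [List.getD_eq_getElem _ _ hlt, List.getD_eq_getElem _ _ hj, hj1] at this
  have h1 := (hp _).1 (List.getElem_mem hlt)
  rw [List.getLast?_eq_getElem?, List.getElem?_eq_getElem hlt]
  congr 1
  omega

lemma IsGoodForest.perm_length {Q : List UBTree} (h : IsGoodForest Q) :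
    (forestBfs UBTree.label Q).Perm
      (List.range' 1 (forestBfs UBTree.label Q).length) := by
  rw [length_forestBfs]
  exact h.perm

lemma isGoodForest_leaf_cons_iff {Q : List UBTree} (h : IsGoodForest Q) (hQ : Q ≠ []) {v : ℕ}
    (hv : 1 ≤ v) (hv' : v ≤ forestSize Q + 1) :
    IsGoodForest (.lf v :: Q.map (UBTree.map (shiftUp v))) ↔
      v ∈ cuts (forestBfs UBTree.label Q) ∧ (AllLeaves Q → v ≠ 1) := by
  rw [isGoodForest_cons_iff (Q := Q) (t := .lf v) hv hv' (by simp [UBTree.children, UBTree.label]),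
    mem_cuts, length_forestBfs]
  have hl : AllLeaves (.lf v :: Q.map (UBTree.map (shiftUp v))) ↔ AllLeaves Q := by
    rw [← allLeaves_map (shiftUp v) Q]
    simp [AllLeaves, UBTree.children]
  have hlast : AllLeaves Q → ((∀ y ∈ ((forestBfs UBTree.label Q).map (shiftUp v)).getLast?,
      y ≤ v) ↔ v ≠ 1) := by
    intro hQl
    rw [List.getLast?_map, h.getLast?_of_allLeaves hQ hQl]
    simp only [Option.map_some, Option.mem_def, Option.some.injEq, forall_eq', shiftUp]
    split_ifs <;> omega
  rw [hl]
  simp only [UBTree.children, UBTree.label]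
  simp only [h, hv, hv', true_and, List.not_mem_nil, false_imp_iff, implies_true]
  exact and_congr_right fun _ => forall_congr' hlast

lemma isGoodForest_node_cons_iff {ts cs : List UBTree} (h : IsGoodForest (ts ++ cs))
    (hcs : cs ≠ []) {t : UBTree} (ht : t.children = cs.map (UBTree.map (shiftUp t.label)))
    (hv : 1 ≤ t.label) (hv' : t.label ≤ forestSize (ts ++ cs) + 1) :
    IsGoodForest (t :: ts.map (UBTree.map (shiftUp t.label))) ↔ t.label = 1 := by
  rw [isGoodForest_cons_iff hv hv' (by simp [ht])]
  have hl : ¬ AllLeaves (t :: ts.map (UBTree.map (shiftUp t.label))) := by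
    intro hl
    have := hl t (by simp)
    simp [ht, hcs] at this
  simp only [h, hl, false_imp_iff, and_true, true_and, ht, List.forall_mem_map, UBTree.label_map,
    lt_shiftUp_iff]
  constructor
  · rintro ⟨h1, h2⟩
    rcases cs.eq_nil_or_concat with rfl | ⟨cs, c, rfl⟩
    · exact absurd rfl hcs
    · rw [List.concat_eq_append, ← List.append_assoc] at h h1
      exact h.eq_one_of_isCut hv (h2 c (by simp)) h1
  · intro h1
    rw [h1]
    exact ⟨(mem_cuts.1 (one_mem_cuts h.perm_length)).2,
      fun c hc => h.one_le_label (List.mem_append_right _ hc)⟩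

section Weight

open PowerSeries

variable {U r : ℚ⟦X⟧}

/-- The generating function of the trees to be counted whose breadth-first traversal
passes through the forest `Q`, by the number of vertices before `Q`. -/
noncomputable def forestWeight (U r : ℚ⟦X⟧) (Q : List UBTree) : ℚ⟦X⟧ :=
  open Classical in (1 + U) * U ^ (Q.length - 1) *
    r ^ ((cuts (forestBfs UBTree.label Q)).card - if AllLeaves Q then 1 else 0)

lemma exists_leaf_children {Q : List UBTree} (h : IsGoodForest Q) (hQ : Q ≠ [])
    (hr : r = 1 + X * U * r ^ 2) :
    ∃ S : Finset (List UBTree), (∀ Q', Q' ∈ S ↔ IsGoodForest Q' ∧ forestTail Q' = Q ∧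
      ∃ v ts, Q' = .lf v :: ts) ∧
      X * ∑ Q' ∈ S, forestWeight U r Q' = forestWeight U r Q - (1 + U) * U ^ (Q.length - 1) := by
  classical
  obtain ⟨A, hA⟩ : ∃ A, A = {v ∈ cuts (forestBfs UBTree.label Q) | AllLeaves Q → v ≠ 1} :=
    ⟨_, rfl⟩
  have hinj : Function.Injective fun v => UBTree.lf v :: Q.map (UBTree.map (shiftUp v)) := by
    intro v w hvw
    simp only [List.cons.injEq, UBTree.lf.injEq] at hvw
    exact hvw.1
  refine ⟨A.image fun v => .lf v :: Q.map (UBTree.map (shiftUp v)), fun Q' => ?_, ?_⟩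
  · rw [Finset.mem_image]
    constructor
    · rintro ⟨v, hv, rfl⟩
      rw [hA, Finset.mem_filter] at hv
      have hb := (mem_cuts.1 hv.1).1
      rw [length_forestBfs] at hb
      have hg := (isGoodForest_leaf_cons_iff h hQ hb.1 hb.2).2 hv
      exact ⟨hg, (forestTail_eq_iff hg).2 (by simp [UBTree.children, UBTree.label]), _, _, rfl⟩
    · rintro ⟨hg, ht, v, ts, rfl⟩
      have hb := hg.label_bounds
      rw [← forestSize_forestTail, ht] at hb
      rw [forestTail_eq_iff hg] at ht
      simp only [UBTree.children, UBTree.label, List.append_nil] at ht hb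
      subst ht
      exact ⟨v, hA ▸ Finset.mem_filter.2 ((isGoodForest_leaf_cons_iff h hQ hb.1 hb.2).1 hg), rfl⟩
  · rw [Finset.sum_image hinj.injOn]
    have hgeom : ∀ n, X * U * ∑ j ∈ Finset.range n, r ^ (j + 2) = r ^ n - 1 := by
      intro n
      induction n with
      | zero => simp
      | succ n ih =>
        rw [Finset.sum_range_succ, mul_add, ih]
        linear_combination (-r ^ n) * hr
    have hlen : 0 < Q.length := List.length_pos_of_ne_nil hQ
    have hterm : ∀ v ∈ cuts (forestBfs UBTree.label Q),
        forestWeight U r (.lf v :: Q.map (UBTree.map (shiftUp v))) =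
          (1 + U) * U ^ Q.length *
          r ^ ({w ∈ cuts (forestBfs UBTree.label Q) | w ≤ v}.card + 1 -
            if AllLeaves Q then 1 else 0) := by
      intro v hv
      have hl : AllLeaves (.lf v :: Q.map (UBTree.map (shiftUp v))) ↔ AllLeaves Q := by
        rw [← allLeaves_map (shiftUp v) Q]
        simp [AllLeaves, UBTree.children]
      rw [forestWeight, forestBfs_cons, UBTree.children, List.append_nil, forestBfs_label_map,
        UBTree.label, card_cuts_cons_shiftUp h.perm_length hv]
      simp only [hl, List.length_cons, List.length_map, Nat.add_sub_cancel]
    rw [Finset.sum_congr rfl fun v hv => hterm v (Finset.mem_of_mem_filter v (hA ▸ hv)),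
      forestWeight]
    have h1 := one_mem_cuts h.perm_length
    have hU : U ^ Q.length = U * U ^ (Q.length - 1) := (mul_pow_sub_one hlen.ne' U).symm
    have hpos : 0 < (cuts (forestBfs UBTree.label Q)).card := Finset.card_pos.2 ⟨1, h1⟩
    by_cases hl : AllLeaves Q
    · have hA' : A = (cuts (forestBfs UBTree.label Q)).erase 1 := by
        rw [hA, ← Finset.filter_ne']
        simp [hl]
      have hsum := sum_rank (fun j => r ^ j) (cuts (forestBfs UBTree.label Q))
      rw [← Finset.add_sum_erase _ _ h1, filter_cuts_le_one h.perm_length] at hsum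
      obtain ⟨n, hn⟩ : ∃ n, (cuts (forestBfs UBTree.label Q)).card = n + 1 :=
        ⟨_, (Nat.sub_add_cancel hpos).symm⟩
      rw [hn, Finset.sum_range_succ', Finset.card_singleton, add_comm, zero_add,
        add_left_inj] at hsum
      simp only [hl, if_true, Nat.add_sub_cancel]
      rw [hA', ← Finset.mul_sum, hsum, hn, Nat.add_sub_cancel, hU]
      linear_combination (1 + U) * U ^ (Q.length - 1) * hgeom n
    · have hA' : A = cuts (forestBfs UBTree.label Q) := by
        rw [hA]
        simp [hl]
      simp only [hl, if_false, Nat.sub_zero]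
      rw [hA', ← Finset.mul_sum, sum_rank fun j => r ^ (j + 1), hU]
      linear_combination (1 + U) * U ^ (Q.length - 1) *
        hgeom (cuts (forestBfs UBTree.label Q)).card

lemma forestWeight_node {ts cs : List UBTree} (h : IsGoodForest (ts ++ cs))
    (hcs : cs ≠ []) {t : UBTree} (ht : t.children = cs.map (UBTree.map (shiftUp 1)))
    (ht1 : t.label = 1) :
    forestWeight U r (t :: ts.map (UBTree.map (shiftUp 1))) =
      (1 + U) * U ^ ts.length * r ^ 2 := by
  have hl : ¬ AllLeaves (t :: ts.map (UBTree.map (shiftUp 1))) := by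
    intro hl
    have := hl t (by simp)
    simp [ht, hcs] at this
  rw [forestWeight, forestBfs_cons, ht, ← List.map_append, forestBfs_label_map, ht1,
    card_cuts_cons_shiftUp h.perm_length (one_mem_cuts h.perm_length),
    filter_cuts_le_one h.perm_length]
  simp [hl]

lemma mem_node_children_iff {Q : List UBTree} (h : IsGoodForest Q) (Q' : List UBTree) :
    (IsGoodForest Q' ∧ forestTail Q' = Q ∧ ∃ t ts, Q' = t :: ts ∧ t.children ≠ []) ↔
      (∃ ts c, Q = ts ++ [c] ∧
        Q' = .un 1 (c.map (shiftUp 1)) :: ts.map (UBTree.map (shiftUp 1))) ∨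
      (∃ ts c d, Q = ts ++ [c, d] ∧ Q' = .bin 1 (c.map (shiftUp 1)) (d.map (shiftUp 1)) ::
        ts.map (UBTree.map (shiftUp 1))) := by
  constructor
  · rintro ⟨hg, ht, t, ts, rfl, hne⟩
    have hb := hg.label_bounds
    rw [← forestSize_forestTail, ht] at hb
    rw [forestTail_eq_iff hg, eq_comm, List.map_eq_append_iff] at ht
    obtain ⟨ts, cs, rfl, rfl, hcs⟩ := ht
    have hcs' : cs ≠ [] := by
      rintro rfl
      exact hne hcs.symm
    have h1 := (isGoodForest_node_cons_iff h hcs' hcs.symm hb.1 hb.2).1 hg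
    rw [h1] at hcs ⊢
    cases t with
    | lf a => exact absurd rfl hne
    | un a t =>
      simp only [UBTree.children, List.map_eq_cons_iff, List.map_eq_nil_iff] at hcs
      obtain ⟨c, _, rfl, rfl, rfl⟩ := hcs
      obtain rfl : a = 1 := h1
      exact Or.inl ⟨ts, c, rfl, rfl⟩
    | bin a t s =>
      simp only [UBTree.children, List.map_eq_cons_iff, List.map_eq_nil_iff] at hcs
      obtain ⟨c, _, rfl, rfl, d, _, rfl, rfl, rfl⟩ := hcs
      obtain rfl : a = 1 := h1
      exact Or.inr ⟨ts, c, d, rfl, rfl⟩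
  · rintro (⟨ts, c, rfl, rfl⟩ | ⟨ts, c, d, rfl, rfl⟩)
    · have hg := (isGoodForest_node_cons_iff h (by simp) (t := .un 1 (c.map (shiftUp 1)))
        (by simp [UBTree.children, UBTree.label]) le_rfl (by simp [UBTree.label])).2 rfl
      exact ⟨hg, (forestTail_eq_iff hg).2 (by simp [UBTree.children, UBTree.label]), _, _, rfl,
        by simp [UBTree.children]⟩
    · have hg := (isGoodForest_node_cons_iff h (by simp)
        (t := .bin 1 (c.map (shiftUp 1)) (d.map (shiftUp 1)))
        (by simp [UBTree.children, UBTree.label]) le_rfl (by simp [UBTree.label])).2 rfl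
      exact ⟨hg, (forestTail_eq_iff hg).2 (by simp [UBTree.children, UBTree.label]), _, _, rfl,
        by simp [UBTree.children]⟩

lemma exists_node_children {Q : List UBTree} (h : IsGoodForest Q) (hQ : Q ≠ [])
    (hU : U = X * (1 + U) * r ^ 2) :
    ∃ S : Finset (List UBTree), (∀ Q', Q' ∈ S ↔ IsGoodForest Q' ∧ forestTail Q' = Q ∧
      ∃ t ts, Q' = t :: ts ∧ t.children ≠ []) ∧
      (if Q.length = 1 then 1 else 0) + X * ∑ Q' ∈ S, forestWeight U r Q' =
        (1 + U) * U ^ (Q.length - 1) := by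
  classical
  simp only [mem_node_children_iff h]
  rcases Q.eq_nil_or_concat with rfl | ⟨ts, c, rfl⟩
  · exact absurd rfl hQ
  rw [List.concat_eq_append] at h ⊢
  have hun := forestWeight_node (U := U) (r := r) h (by simp)
    (t := .un 1 (c.map (shiftUp 1))) (by simp [UBTree.children]) rfl
  rcases ts.eq_nil_or_concat with rfl | ⟨ts, d, rfl⟩
  · refine ⟨{[.un 1 (c.map (shiftUp 1))]}, fun Q' => ?_, ?_⟩
    · rw [Finset.mem_singleton]
      constructor
      · rintro rfl
        exact Or.inl ⟨[], c, rfl, rfl⟩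
      · rintro (⟨ts, c', h1, rfl⟩ | ⟨ts, c', d', h1, -⟩)
        · obtain ⟨rfl, h3⟩ := List.append_inj' h1 rfl
          obtain rfl : c = c' := by simpa using h3
          rfl
        · have := congrArg List.length h1
          simp at this
    · rw [List.map_nil] at hun
      rw [Finset.sum_singleton, hun]
      simp only [List.nil_append, List.length_singleton, List.length_nil, if_true, Nat.sub_self,
        pow_zero]
      linear_combination -hU
  · rw [List.concat_eq_append] at h hun ⊢
    rw [List.append_assoc, List.singleton_append] at h ⊢
    have hbin := forestWeight_node (U := U) (r := r) h (by simp)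
      (t := .bin 1 (d.map (shiftUp 1)) (c.map (shiftUp 1))) (by simp [UBTree.children]) rfl
    refine ⟨{.un 1 (c.map (shiftUp 1)) :: (ts ++ [d]).map (UBTree.map (shiftUp 1)),
      .bin 1 (d.map (shiftUp 1)) (c.map (shiftUp 1)) :: ts.map (UBTree.map (shiftUp 1))},
      fun Q' => ?_, ?_⟩
    · rw [Finset.mem_insert, Finset.mem_singleton]
      refine or_congr ⟨?_, ?_⟩ ⟨?_, ?_⟩
      · rintro rfl
        exact ⟨ts ++ [d], c, by simp, rfl⟩
      · rintro ⟨ts', c', h1, rfl⟩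
        obtain ⟨rfl, h3⟩ := List.append_inj' (s₁ := ts ++ [d]) (t₁ := [c]) (s₂ := ts') (t₂ := [c'])
          (by simpa using h1) rfl
        obtain rfl : c = c' := by simpa using h3
        rfl
      · rintro rfl
        exact ⟨ts, d, c, rfl, rfl⟩
      · rintro ⟨ts', c', d', h1, rfl⟩
        obtain ⟨rfl, h3⟩ := List.append_inj' h1 rfl
        obtain ⟨rfl, rfl⟩ : d = c' ∧ c = d' := by simpa using h3
        rfl
    · rw [Finset.sum_pair (by simp), hun, hbin]
      simp only [List.length_append, List.length_cons, List.length_nil]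
      rw [if_neg (by omega), show ts.length + (0 + 1 + 1) - 1 = ts.length + 1 by omega]
      linear_combination (-(1 + U) * U ^ ts.length) * hU

end Weight

section Series

open PowerSeries

/-- The coefficients of the power series `V` such that `V = Z - X * V ^ 2`, where `z` is the
sequence of coefficients of `Z`. -/
def quadraticCoeff (z : ℕ → ℚ) : ℕ → ℚ
  | 0 => z 0
  | n + 1 => z (n + 1) - ∑ i : Fin n.succ, quadraticCoeff z i * quadraticCoeff z (n - i)

lemma exists_eq_sub_X_mul_sq (Z : ℚ⟦X⟧) : ∃ V : ℚ⟦X⟧, V = Z - X * V ^ 2 := by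
  refine ⟨mk (quadraticCoeff fun n => coeff n Z), ?_⟩
  ext n
  cases n with
  | zero => simp [quadraticCoeff]
  | succ n =>
    rw [map_sub, coeff_succ_X_mul, sq, coeff_mul, coeff_mk, quadraticCoeff]
    simp only [coeff_mk]
    rw [Finset.Nat.sum_antidiagonal_eq_sum_range_succ_mk, Finset.sum_range]

lemma exists_kernel_solution : ∃ U r : ℚ⟦X⟧, constantCoeff U = 0 ∧ constantCoeff r = 1 ∧
    U = X * (1 + U) * r ^ 2 ∧ r = 1 + X * U * r ^ 2 ∧
    (1 + U) * r = mk fun n => (catalan n : ℚ) := by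
  obtain ⟨C, hC⟩ : ∃ C : ℚ⟦X⟧, C = mk fun n => (catalan n : ℚ) := ⟨_, rfl⟩
  have hCeq : C = 1 + X * C ^ 2 := by
    have h := congrArg (PowerSeries.map (Nat.castRingHom ℚ)) catalanSeries_sq_mul_X_add_one
    have h' : PowerSeries.map (Nat.castRingHom ℚ) catalanSeries = C := by
      ext n
      simp [hC]
    rw [map_add, map_mul, map_pow, h', map_X, map_one] at h
    linear_combination -h
  obtain ⟨V, hV⟩ := exists_eq_sub_X_mul_sq (C ^ 2)
  have hU0 : constantCoeff (1 + X * V) ≠ 0 := by simp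
  have hCU : C = 1 + X * V + (X * V) ^ 2 := by linear_combination hCeq - X * hV
  have hne : (1 + X * V) ≠ 0 := fun h => hU0 (by rw [h, map_zero])
  obtain ⟨r, hr⟩ : ∃ r, (1 + X * V) * r = C :=
    ⟨(1 + X * V)⁻¹ * C, by rw [← mul_assoc, PowerSeries.mul_inv_cancel _ hU0, one_mul]⟩
  have h1 : X * V = X * (1 + X * V) * r ^ 2 := by
    apply mul_left_cancel₀ hne
    linear_combination hCeq - hCU - X * ((1 + X * V) * r + C) * hr
  refine ⟨X * V, r, by simp, ?_, h1, ?_, hr.trans hC⟩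
  · have hC0 : constantCoeff C = 1 := by
      rw [← coeff_zero_eq_constantCoeff_apply, hC, coeff_mk, catalan_zero, Nat.cast_one]
    simpa [hC0] using congrArg constantCoeff hr
  · apply mul_left_cancel₀ hne
    linear_combination hr + hCU + X * V * h1

lemma constantCoeff_forestWeight {U r : ℚ⟦X⟧} (hU : constantCoeff U = 0)
    (hr : constantCoeff r = 1) {Q : List UBTree} (hQ : Q ≠ []) :
    constantCoeff (forestWeight U r Q) = if Q.length = 1 then 1 else 0 := by
  have := List.length_pos_of_ne_nil hQ
  by_cases h : Q.length = 1
  · simp [forestWeight, h, hU, hr]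
  · have h' : Q.length - 1 ≠ 0 := by omega
    simp [forestWeight, h, h', hU]

end Series

/-- The good forests with `k + 1` vertices form a finite set whose total weight, in the
appropriate degree, does not depend on `k`. -/
lemma exists_goodForests {U r : PowerSeries ℚ} (hU : U = PowerSeries.X * (1 + U) * r ^ 2)
    (hr : r = 1 + PowerSeries.X * U * r ^ 2) (k : ℕ) :
    ∃ S : Finset (List UBTree), (∀ Q, Q ∈ S ↔ IsGoodForest Q ∧ forestSize Q = k + 1) ∧
      ∀ m, ∑ Q ∈ S, PowerSeries.coeff m (forestWeight U r Q) =
        PowerSeries.coeff (m + k) ((1 + U) * r) := by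
  classical
  induction k with
  | zero =>
    have hg : IsGoodForest [.lf 1] := by
      refine (isGoodForest_singleton _).2 ⟨⟨trivial, List.Perm.refl _, ?_⟩, ?_⟩
      · exact (avoids213_cons 1 []).2 ⟨List.Pairwise.nil, avoids213_nil⟩
      · intro j hj _
        obtain rfl : j = 0 := by simpa [UBTree.size] using hj
        exact le_rfl
    refine ⟨{[.lf 1]}, fun Q => ?_, fun m => ?_⟩
    · rw [Finset.mem_singleton]
      constructor
      · rintro rfl
        exact ⟨hg, rfl⟩
      · rintro ⟨h, hs⟩
        cases Q with
        | nil => simp at hs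
        | cons t ts =>
          have hb := h.label_bounds
          rw [forestSize_cons] at hs
          have h0 : ts ++ t.children = [] := forestSize_eq_zero.1 (by omega)
          rw [List.append_eq_nil_iff] at h0
          have hl : t.label = 1 := by rw [forestSize_cons] at hb; omega
          rw [h0.1]
          congr 1
          exact UBTree.ext_label_children hl h0.2
    · rw [Finset.sum_singleton, forestWeight]
      have hcard : (cuts (forestBfs UBTree.label [.lf 1])).card = 2 := by
        have hp : ([] : List ℕ).Perm (List.range' 1 ([] : List ℕ).length) := List.Perm.refl _
        have := card_cuts_cons_shiftUp hp (one_mem_cuts hp)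
        rwa [filter_cuts_le_one hp, Finset.card_singleton] at this
      have hl : AllLeaves [.lf 1] := by simp [AllLeaves, UBTree.children]
      rw [hcard, if_pos hl]
      simp
  | succ k ih =>
    obtain ⟨S, hS, hsum⟩ := ih
    have hchildren : ∀ Q : List UBTree, ∃ T : Finset (List UBTree), Q ∈ S →
        (∀ Q', Q' ∈ T ↔ IsGoodForest Q' ∧ forestTail Q' = Q) ∧
        (if Q.length = 1 then 1 else 0) + PowerSeries.X * ∑ Q' ∈ T, forestWeight U r Q' =
          forestWeight U r Q := by
      intro Q
      by_cases hQS : Q ∈ S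
      · have hQ := (hS Q).1 hQS
        have hne : Q ≠ [] := by
          rintro rfl
          simp at hQ
        obtain ⟨A, hA, hA'⟩ := exists_leaf_children hQ.1 hne hr
        obtain ⟨B, hB, hB'⟩ := exists_node_children hQ.1 hne hU
        refine ⟨A ∪ B, fun _ => ⟨fun Q' => ?_, ?_⟩⟩
        · rw [Finset.mem_union, hA, hB]
          constructor
          · rintro (h | h)
            · exact ⟨h.1, h.2.1⟩
            · exact ⟨h.1, h.2.1⟩
          · rintro ⟨h, h'⟩
            cases Q' with
            | nil => exact absurd h'.symm hne
            | cons t ts =>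
              cases t with
              | lf a => exact Or.inl ⟨h, h', a, ts, rfl⟩
              | un a t => exact Or.inr ⟨h, h', _, ts, rfl, by simp [UBTree.children]⟩
              | bin a s t => exact Or.inr ⟨h, h', _, ts, rfl, by simp [UBTree.children]⟩
        · rw [Finset.sum_union]
          · linear_combination hA' + hB'
          · rw [Finset.disjoint_left]
            intro Q' h1 h2
            obtain ⟨_, _, v, ts, rfl⟩ := (hA _).1 h1
            obtain ⟨_, _, t, ts', h, h'⟩ := (hB _).1 h2
            obtain ⟨rfl, rfl⟩ := List.cons.inj h
            exact h' rfl
      · exact ⟨∅, fun h => absurd h hQS⟩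
    choose T hT using hchildren
    refine ⟨S.biUnion T, fun Q' => ?_, fun m => ?_⟩
    · rw [Finset.mem_biUnion]
      constructor
      · rintro ⟨Q, hQ, hQ'⟩
        obtain ⟨h, rfl⟩ := ((hT Q hQ).1 Q').1 hQ'
        have hs := ((hS _).1 hQ).2
        cases Q' with
        | nil => simp [forestTail] at hs
        | cons t ts => exact ⟨h, by rw [← forestSize_forestTail, hs]⟩
      · rintro ⟨h, hs⟩
        have hne : Q' ≠ [] := by
          rintro rfl
          simp at hs
        have hmem : forestTail Q' ∈ S := by
          refine (hS _).2 ⟨h.tail hne, ?_⟩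
          cases Q' with
          | nil => exact absurd rfl hne
          | cons t ts =>
            rw [← forestSize_forestTail] at hs
            omega
        exact ⟨_, hmem, ((hT _ hmem).1 Q').2 ⟨h, rfl⟩⟩
    · rw [Finset.sum_biUnion, ← add_assoc, add_right_comm, ← hsum]
      · refine Finset.sum_congr rfl fun Q hQ => ?_
        rw [← (hT Q hQ).2, map_add, PowerSeries.coeff_succ_X_mul, map_sum]
        split_ifs <;> simp [PowerSeries.coeff_one]
      · intro Q hQ R hR hne
        rw [Function.onFun, Finset.disjoint_left]
        intro Q' h1 h2
        exact hne ((((hT Q hQ).1 Q').1 h1).2.symm.trans (((hT R hR).1 Q').1 h2).2)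

/-- The `(n-1)`-st Catalan number counts `n`-vertex increasing unary-binary trees with
associated permutation avoiding 213 such that, among the leaves read after the last
node in BFS order, the last leaf has the smallest label. -/
theorem stmt13 (n : ℕ) (hn : 1 ≤ n) :
    catalan (n - 1) =
      Nat.card {t : UBTree // t.size = n ∧ IsGoodUB t ∧ LastLeafProp t} := by
  obtain ⟨U, r, hU0, hr0, hU, hr, hC⟩ := exists_kernel_solution
  obtain ⟨k, rfl⟩ : ∃ k, n = k + 1 := ⟨n - 1, by omega⟩
  obtain ⟨S, hS, hsum⟩ := exists_goodForests hU hr k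
  have h0 := hsum 0
  have hweight : ∀ Q ∈ S, PowerSeries.coeff 0 (forestWeight U r Q) =
      if Q.length = 1 then 1 else 0 := by
    intro Q hQ
    rw [PowerSeries.coeff_zero_eq_constantCoeff_apply]
    refine constantCoeff_forestWeight hU0 hr0 ?_
    rintro rfl
    have := ((hS _).1 hQ).2
    simp at this
  rw [Finset.sum_congr rfl hweight, Finset.sum_boole, hC, zero_add, PowerSeries.coeff_mk,
    Nat.cast_inj] at h0
  rw [Nat.add_sub_cancel, ← h0, ← Nat.card_eq_finsetCard]
  refine (Nat.card_congr (Equiv.ofBijective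
    (fun t => ⟨[t.1], Finset.mem_filter.2 ⟨(hS _).2
      ⟨(isGoodForest_singleton _).2 t.2.2, by simpa [forestSize] using t.2.1⟩, rfl⟩⟩)
    ⟨?_, ?_⟩)).symm
  · intro s t h
    simpa [Subtype.ext_iff] using h
  · rintro ⟨Q, hQ⟩
    obtain ⟨hQS, hl⟩ := Finset.mem_filter.1 hQ
    obtain ⟨t, rfl⟩ := List.length_eq_one_iff.1 hl
    obtain ⟨hg, hs⟩ := (hS _).1 hQS
    exact ⟨⟨t, by simpa [forestSize] using hs, (isGoodForest_singleton t).1 hg⟩, rfl⟩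
end

section
/- Let g_n denote the number of basketball walks of length n from 0 to 1 that are positive except at the origin, and let a_n denote the number of nonnegative basketball walks of length n from 0 to 0. Then for every n ≥ 1, g_n = a_{n-1} + ∑_{i ≥ 0, j ≥ 1, 1+i+j = n} a_i · g_j. -/
/-- Height of a walk (given by its list of steps) after `i` steps. -/
def ht (s : List ℤ) (i : ℕ) : ℤ := (s.take i).sum

/-- A basketball walk: every step lies in `{-2, -1, 1, 2}`. -/
def IsBasketball (s : List ℤ) : Prop := ∀ x ∈ s, x = -2 ∨ x = -1 ∨ x = 1 ∨ x = 2

/-- A C-walk: a basketball walk from 0 to 0 that visits 1 and is positive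
except at its extremities. -/
def IsCWalk (s : List ℤ) : Prop :=
  IsBasketball s ∧ ht s s.length = 0 ∧
    (∀ i, 0 < i → i < s.length → 0 < ht s i) ∧ ∃ i, i ≤ s.length ∧ ht s i = 1

/-- A G-walk: a basketball walk from 0 to 1 that is positive except at the origin. -/
def IsGWalk (s : List ℤ) : Prop :=
  IsBasketball s ∧ ht s s.length = 1 ∧ ∀ i, 1 ≤ i → i ≤ s.length → 0 < ht s i

/-- An A-walk (basketball excursion): a nonnegative basketball walk from 0 to 0. -/
def IsAWalk (s : List ℤ) : Prop :=
  IsBasketball s ∧ ht s s.length = 0 ∧ ∀ i, i ≤ s.length → 0 ≤ ht s i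

/-- A B-walk: a basketball walk from 0 to 1 that visits 0 and 1 only at its extremities. -/
def IsBWalk (s : List ℤ) : Prop :=
  IsBasketball s ∧ ht s s.length = 1 ∧
    ∀ i, 0 < i → i < s.length → ht s i ≠ 0 ∧ ht s i ≠ 1

/-- Number of `±1`-steps of a walk. -/
noncomputable def pmOneSteps (s : List ℤ) : ℕ :=
  Set.ncard {i : ℕ | i < s.length ∧ (s.getD i 0 = 1 ∨ s.getD i 0 = -1)}

/-- Number of steps that are odd `+2`-steps or even `-2`-steps
(the step of index `i`, 0-based, starts at height `ht s i`). -/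
noncomputable def lSteps (s : List ℤ) : ℕ :=
  Set.ncard {i : ℕ | i < s.length ∧
    ((s.getD i 0 = 2 ∧ Odd (ht s i)) ∨ (s.getD i 0 = -2 ∧ Even (ht s i)))}

/-- Number of steps that are odd `-2`-steps or even `+2`-steps. -/
noncomputable def rSteps (s : List ℤ) : ℕ :=
  Set.ncard {i : ℕ | i < s.length ∧
    ((s.getD i 0 = -2 ∧ Odd (ht s i)) ∨ (s.getD i 0 = 2 ∧ Even (ht s i)))}

/-- The (0-based) steps of indices `i < j` are paired: the `i`-th step is a `+2`,
the `j`-th step is a `-2`, the walk after step `j` is back at the height it had before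
step `i`, and strictly in between the walk stays at least one above that height. -/
def Paired (s : List ℤ) (i j : ℕ) : Prop :=
  i < j ∧ j < s.length ∧ s.getD i 0 = 2 ∧ s.getD j 0 = -2 ∧
    ht s (j + 1) = ht s i ∧ ∀ k, i + 1 < k → k ≤ j → ht s i + 1 ≤ ht s k

/-- A staggered `±2`-step: a `±2`-step that is not paired with any other `±2`-step. -/
def IsStaggered (s : List ℤ) (i : ℕ) : Prop :=
  i < s.length ∧ (s.getD i 0 = 2 ∨ s.getD i 0 = -2) ∧
    (∀ j, ¬ Paired s i j) ∧ ∀ j, ¬ Paired s j i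

/-- Number of staggered `±2`-steps of a walk. -/
noncomputable def staggeredCount (s : List ℤ) : ℕ :=
  Set.ncard {i : ℕ | IsStaggered s i}

/-- Number of G-walks of length `n`. -/
noncomputable def gCount (n : ℕ) : ℕ := Nat.card {s : List ℤ // IsGWalk s ∧ s.length = n}

/-- Number of basketball excursions of length `n`. -/
noncomputable def aCount (n : ℕ) : ℕ := Nat.card {s : List ℤ // IsAWalk s ∧ s.length = n}

/-- Number of B-walks of length `n`. -/
noncomputable def bCount (n : ℕ) : ℕ := Nat.card {s : List ℤ // IsBWalk s ∧ s.length = n}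

theorem ht_cons_succ (x : ℤ) (s : List ℤ) (i : ℕ) : ht (x :: s) (i + 1) = x + ht s i := by
  simp [ht]

theorem ht_length (s : List ℤ) : ht s s.length = s.sum := by
  simp [ht]

theorem ht_append (s t : List ℤ) (i : ℕ) : ht (s ++ t) i = ht s i + ht t (i - s.length) := by
  simp [ht, List.take_append]

theorem ht_append_of_le (s t : List ℤ) {i : ℕ} (h : i ≤ s.length) : ht (s ++ t) i = ht s i := by
  simp [ht, List.take_append_of_le_length h]

theorem ht_append_of_ge (s t : List ℤ) {i : ℕ} (h : s.length ≤ i) :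
    ht (s ++ t) i = s.sum + ht t (i - s.length) := by
  rw [ht_append]
  simp [ht, List.take_of_length_le h]

/-- A nonnegative basketball walk from 0 to 1. -/
def IsNonnegWalkToOne (s : List ℤ) : Prop :=
  IsBasketball s ∧ s.sum = 1 ∧ ∀ i, i ≤ s.length → 0 ≤ ht s i

/-- The time reversal of a walk. -/
def walkReverse (s : List ℤ) : List ℤ := (s.map Neg.neg).reverse

theorem walkReverse_walkReverse (s : List ℤ) : walkReverse (walkReverse s) = s := by
  simp [walkReverse]

theorem length_walkReverse (s : List ℤ) : (walkReverse s).length = s.length := by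
  simp [walkReverse]

theorem sum_map_neg (s : List ℤ) : (s.map Neg.neg).sum = -s.sum := by
  induction s with
  | nil => simp
  | cons x s ih => simp [ih]; ring

theorem sum_walkReverse (s : List ℤ) : (walkReverse s).sum = -s.sum := by
  simp [walkReverse, List.sum_reverse, sum_map_neg]

theorem isBasketball_walkReverse {s : List ℤ} :
    IsBasketball (walkReverse s) ↔ IsBasketball s := by
  have key : ∀ t : List ℤ, IsBasketball t → IsBasketball (walkReverse t) := by
    intro t ht x hx
    simp only [walkReverse, List.mem_reverse, List.mem_map] at hx
    obtain ⟨y, hy, rfl⟩ := hx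
    have := ht y hy
    omega
  exact ⟨fun h => by simpa [walkReverse_walkReverse] using key _ h, key s⟩

theorem ht_walkReverse (s : List ℤ) (i : ℕ) :
    ht (walkReverse s) i = ht s (s.length - i) - s.sum := by
  have h := List.sum_take_add_sum_drop s (s.length - i)
  simp only [ht, walkReverse, List.take_reverse, List.length_map, List.sum_reverse,
    ← List.map_drop, sum_map_neg]
  omega

theorem isBasketball_cons {x : ℤ} {s : List ℤ} :
    IsBasketball (x :: s) ↔ (x = -2 ∨ x = -1 ∨ x = 1 ∨ x = 2) ∧ IsBasketball s := by
  simp [IsBasketball]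

theorem isBasketball_append {s t : List ℤ} :
    IsBasketball (s ++ t) ↔ IsBasketball s ∧ IsBasketball t := by
  simp only [IsBasketball, List.mem_append, or_imp, forall_and]

theorem isGWalk_cons {x : ℤ} {s : List ℤ} :
    IsGWalk (x :: s) ↔ (x = -2 ∨ x = -1 ∨ x = 1 ∨ x = 2) ∧ IsBasketball s ∧ x + s.sum = 1 ∧
      ∀ i, i ≤ s.length → 0 < x + ht s i := by
  rw [IsGWalk, isBasketball_cons, ht_length, List.sum_cons, and_assoc]
  refine and_congr_right fun _ => and_congr_right fun _ => and_congr_right fun _ =>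
    ⟨fun h i hi => ?_, fun h i hi hi' => ?_⟩
  · rw [← ht_cons_succ]
    exact h _ (by omega) (by simpa using hi)
  · obtain ⟨j, rfl⟩ : ∃ j, i = j + 1 := ⟨i - 1, by omega⟩
    rw [ht_cons_succ]
    exact h j (by simpa using hi')

theorem isGWalk_one_cons {s : List ℤ} : IsGWalk (1 :: s) ↔ IsAWalk s := by
  rw [isGWalk_cons, IsAWalk, ht_length]
  constructor
  · rintro ⟨-, hb, hs, hp⟩
    exact ⟨hb, by omega, fun i hi => by have := hp i hi; omega⟩
  · rintro ⟨hb, hs, hp⟩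
    exact ⟨by simp, hb, by omega, fun i hi => by have := hp i hi; omega⟩

theorem isGWalk_two_cons_walkReverse {s : List ℤ} :
    IsGWalk (2 :: walkReverse s) ↔ IsNonnegWalkToOne s := by
  rw [isGWalk_cons, IsNonnegWalkToOne, isBasketball_walkReverse, sum_walkReverse,
    length_walkReverse]
  simp only [ht_walkReverse]
  constructor
  · rintro ⟨-, hb, hs, hp⟩
    refine ⟨hb, by omega, fun i hi => ?_⟩
    have := hp (s.length - i) (by omega)
    rw [Nat.sub_sub_self hi] at this
    omega
  · rintro ⟨hb, hs, hp⟩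
    refine ⟨by simp, hb, by omega, fun i hi => ?_⟩
    have := hp (s.length - i) (by omega)
    omega

theorem IsAWalk.append {s t : List ℤ} (hs : IsAWalk s) (ht' : IsGWalk t) :
    IsNonnegWalkToOne (s ++ t) := by
  obtain ⟨hb, hs0, hp⟩ := hs
  obtain ⟨hb', ht1, hp'⟩ := ht'
  rw [ht_length] at hs0 ht1
  refine ⟨isBasketball_append.2 ⟨hb, hb'⟩, by simp [hs0, ht1], fun i hi => ?_⟩
  rw [List.length_append] at hi
  rcases le_or_gt i s.length with h | h
  · rw [ht_append_of_le _ _ h]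
    exact hp i h
  · rw [ht_append_of_ge _ _ h.le, hs0, zero_add]
    exact (hp' _ (by omega) (by omega)).le

/-- Cutting a nonnegative walk from 0 to 1 at its last visit to 0. -/
theorem IsNonnegWalkToOne.exists_append {u : List ℤ} (hu : IsNonnegWalkToOne u) :
    ∃ s t, u = s ++ t ∧ IsAWalk s ∧ IsGWalk t := by
  obtain ⟨hb, h1, hp⟩ := hu
  let k := Nat.findGreatest (fun i => ht u i = 0) u.length
  have hk : k ≤ u.length := Nat.findGreatest_le _
  have hk0 : ht u k = 0 :=
    Nat.findGreatest_spec (P := fun i => ht u i = 0) (Nat.zero_le _) (by simp [ht])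
  have hgt : ∀ i, k < i → i ≤ u.length → ht u i ≠ 0 := fun i hi hi' =>
    Nat.findGreatest_is_greatest hi hi'
  clear_value k
  have hsplit := List.take_append_drop k u
  have hlen : (u.take k).length = k := by simpa using hk
  have hlen' : (u.drop k).length = u.length - k := by simp
  have hsum : (u.take k).sum = 0 := hk0
  have hbb := isBasketball_append.1 (hsplit.symm ▸ hb)
  refine ⟨u.take k, u.drop k, hsplit.symm, ⟨hbb.1, by rw [ht_length, hsum], fun i hi => ?_⟩,
    hbb.2, ?_, fun i hi hi' => ?_⟩
  · rw [← ht_append_of_le _ (u.drop k) hi, hsplit]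
    exact hp i (by omega)
  · have := List.sum_take_add_sum_drop u k
    rw [ht_length]
    omega
  · have h := ht_append_of_ge (u.take k) (u.drop k) (i := k + i) (by omega)
    rw [hsplit, hlen, hsum, zero_add, Nat.add_sub_cancel_left] at h
    rw [← h]
    exact lt_of_le_of_ne (hp _ (by omega)) (hgt _ (by omega) (by omega)).symm

theorem length_le_of_append_eq {s t s' t' : List ℤ} (hs : IsAWalk s) (ht' : IsGWalk t)
    (hs' : IsAWalk s') (h : s ++ t = s' ++ t') : s'.length ≤ s.length := by
  by_contra! hlt
  have h₀ := ht_append_of_le s' t' le_rfl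
  have h₁ := hs.2.1
  have hl := congrArg List.length h
  simp only [List.length_append] at hl
  rw [ht_length] at h₁
  rw [hs'.2.1, ← h, ht_append_of_ge _ _ hlt.le, h₁, zero_add] at h₀
  have := ht'.2.2 (s'.length - s.length) (by omega) (by omega)
  omega

theorem finite_isBasketball_length (n : ℕ) :
    {s : List ℤ | IsBasketball s ∧ s.length = n}.Finite := by
  have hA : ({-2, -1, 1, 2} : Set ℤ).Finite := by simp
  have := hA.to_subtype
  refine ((List.finite_length_eq ({-2, -1, 1, 2} : Set ℤ) n).image
    (List.map Subtype.val)).subset ?_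
  rintro s ⟨hb, hl⟩
  refine ⟨s.attachWith _ fun x hx => ?_, by simpa using hl, by simp⟩
  simpa using hb x hx

instance finite_aWalks (n : ℕ) : Finite {s : List ℤ // IsAWalk s ∧ s.length = n} :=
  ((finite_isBasketball_length n).subset fun _ h => ⟨h.1.1, h.2⟩ :
    {s : List ℤ | IsAWalk s ∧ s.length = n}.Finite)

instance finite_gWalks (n : ℕ) : Finite {s : List ℤ // IsGWalk s ∧ s.length = n} :=
  ((finite_isBasketball_length n).subset fun _ h => ⟨h.1.1, h.2⟩ :
    {s : List ℤ | IsGWalk s ∧ s.length = n}.Finite)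

/-- Assembling a G-walk of length `m + 1` from either an excursion, preceded by a `+1`-step,
or an excursion followed by a G-walk, reversed and preceded by a `+2`-step. -/
def assembleGWalk (m : ℕ) :
    ({s : List ℤ // IsAWalk s ∧ s.length = m} ⊕
      Σ i : Fin m, {s : List ℤ // IsAWalk s ∧ s.length = i} ×
        {s : List ℤ // IsGWalk s ∧ s.length = m - i}) →
    {s : List ℤ // IsGWalk s ∧ s.length = m + 1}
  | .inl a => ⟨1 :: a.1, isGWalk_one_cons.2 a.2.1, by simp [a.2.2]⟩
  | .inr ⟨i, a, g⟩ => ⟨2 :: walkReverse (a.1 ++ g.1),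
      isGWalk_two_cons_walkReverse.2 (a.2.1.append g.2.1), by
        simp [length_walkReverse, a.2.2, g.2.2]⟩

theorem assembleGWalk_injective (m : ℕ) : Function.Injective (assembleGWalk m) := by
  rintro (⟨a, ha, hal⟩ | ⟨i, ⟨a, ha, hal⟩, ⟨g, hg, hgl⟩⟩)
    (⟨b, hb, hbl⟩ | ⟨j, ⟨b, hb, hbl⟩, ⟨f, hf, hfl⟩⟩) h
  · simpa [assembleGWalk] using h
  · simp [assembleGWalk] at h
  · simp [assembleGWalk] at h
  · simp only [assembleGWalk, Subtype.mk.injEq, List.cons.injEq, true_and] at h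
    have h' : a ++ g = b ++ f := by
      rw [← walkReverse_walkReverse (a ++ g), h, walkReverse_walkReverse]
    have hle := length_le_of_append_eq ha hg hb h'
    have hge := length_le_of_append_eq hb hf ha h'.symm
    obtain ⟨rfl, rfl⟩ := List.append_inj h' (by omega)
    obtain rfl : i = j := Fin.ext (by omega)
    rfl

theorem assembleGWalk_surjective (m : ℕ) : Function.Surjective (assembleGWalk m) := by
  rintro ⟨_ | ⟨x, s⟩, hs, hl⟩
  · simp at hl
  have hl' : s.length = m := by simpa using hl
  have hx := (isGWalk_cons.1 hs).2.2.2 0 (Nat.zero_le _)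
  simp only [ht, List.take_zero, List.sum_nil, add_zero] at hx
  obtain rfl | rfl : x = 1 ∨ x = 2 := by
    have := (isGWalk_cons.1 hs).1
    omega
  · exact ⟨.inl ⟨s, isGWalk_one_cons.1 hs, hl'⟩, rfl⟩
  · rw [← walkReverse_walkReverse s, isGWalk_two_cons_walkReverse] at hs
    obtain ⟨a, g, hag, ha, hg⟩ := hs.exists_append
    have hlen := congrArg List.length hag
    rw [length_walkReverse, List.length_append, hl'] at hlen
    have hg0 : g.length ≠ 0 := by
      intro h0
      rw [List.length_eq_zero_iff] at h0
      subst h0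
      simpa [ht] using hg.2.1
    refine ⟨.inr ⟨⟨a.length, by omega⟩, ⟨a, ha, rfl⟩, ⟨g, hg, ?_⟩⟩, ?_⟩
    · simp only
      omega
    · simp [assembleGWalk, ← hag, walkReverse_walkReverse]

/-- The recurrence `g_n = a_{n-1} + ∑_{1+i+j=n, j ≥ 1} a_i g_j`. -/
theorem stmt14 (n : ℕ) (hn : 1 ≤ n) :
    gCount n = aCount (n - 1) +
      ∑ i ∈ Finset.range (n - 1), aCount i * gCount (n - 1 - i) := by
  obtain ⟨m, rfl⟩ : ∃ m, n = m + 1 := ⟨n - 1, by omega⟩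
  rw [Nat.add_sub_cancel, Finset.sum_range]
  simp only [gCount, aCount]
  rw [← Nat.card_congr (Equiv.ofBijective _
      ⟨assembleGWalk_injective m, assembleGWalk_surjective m⟩),
    Nat.card_sum, Nat.card_sigma]
  simp only [Nat.card_prod]
end

section
/- Let g_n denote the number of basketball walks of length n from 0 to 1 that are positive except at the origin. Then for every n ≥ 1, catalan(n) = g_n + ∑_{i+j = n, i,j ≥ 1} g_i · g_j. (This is the coefficient form of the identity 1 + G(z) + G(z)^2 = C(z), where C is the Catalan generating function.) -/
section Series

open PowerSeries

/-- The solution of `catalan n = g n + ∑_{i+j=n, i,j ≥ 1} g i * g j` with `g 0 = 0`. -/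
def catalanHalf : ℕ → ℤ
  | 0 => 0
  | n + 1 => catalan (n + 1) - ∑ i : Fin n, catalanHalf (i + 1) * catalanHalf (n - i)

theorem catalanHalf_succ (n : ℕ) :
    catalanHalf (n + 1) + ∑ i ∈ Finset.range n, catalanHalf (i + 1) * catalanHalf (n - i) =
      catalan (n + 1) := by
  rw [catalanHalf, ← Fin.sum_univ_eq_sum_range
    (fun i => catalanHalf (i + 1) * catalanHalf (n - i)) n]
  ring

theorem mk_catalanHalf_quadratic :
    1 + mk catalanHalf + mk catalanHalf ^ 2 = (mk fun n => (catalan n : ℤ)) := by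
  ext n
  cases n with
  | zero => simp [catalanHalf, sq]
  | succ n =>
    simp only [map_add, coeff_mk, sq, coeff_mul, ← catalanHalf_succ,
      Finset.Nat.sum_antidiagonal_eq_sum_range_succ_mk]
    rw [Finset.sum_range_succ, Finset.sum_range_succ']
    simp only [coeff_one, Nat.add_eq_zero_iff, one_ne_zero, and_false, if_false, Nat.sub_self,
      Nat.sub_zero, catalanHalf.eq_1, Nat.add_sub_add_right]
    ring

theorem mk_catalan_eq :
    (mk fun n => (catalan n : ℤ)) = 1 + X * (mk fun n => (catalan n : ℤ)) ^ 2 := by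
  have h : catalanSeries.map (Nat.castRingHom ℤ) = mk fun n => (catalan n : ℤ) := by
    ext n; simp
  rw [← h]
  conv_lhs => rw [← catalanSeries_sq_mul_X_add_one]
  simp [mul_comm, add_comm]

/-- The sequence with `f 0 = 1`, `f 1 = q` and `f (k + 2) = q * f (k + 1) - p * f k`. -/
def lucasSeq {R : Type*} [CommRing R] (p q : R) : ℕ → R
  | 0 => 1
  | 1 => q
  | k + 2 => q * lucasSeq p q (k + 1) - p * lucasSeq p q k

variable {R : Type*} [CommRing R] [IsDomain R] {p q x : R}

theorem neg_eq_mul_of_catalan (hu : 1 + q ≠ 0) (hp : p * (1 + q) = -q)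
    (hq : q + q ^ 2 = x * (1 + q + q ^ 2) ^ 2) :
    -p = x * (1 - p * q - p * q ^ 2 + p ^ 2) := by
  apply mul_left_cancel₀ (pow_ne_zero 2 hu)
  grind

theorem eq_mul_of_catalan (hu : 1 + q ≠ 0) (hp : p * (1 + q) = -q)
    (hq : q + q ^ 2 = x * (1 + q + q ^ 2) ^ 2) :
    q = x * (1 + q ^ 2 - p + q ^ 3 - 2 * p * q) := by
  apply mul_left_cancel₀ hu
  grind

theorem lucasSeq_one_eq (hu : 1 + q ≠ 0) (hp : p * (1 + q) = -q)
    (hq : q + q ^ 2 = x * (1 + q + q ^ 2) ^ 2) :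
    lucasSeq p q 1 = x * (lucasSeq p q 0 + lucasSeq p q 2 + lucasSeq p q 3) := by
  simp only [lucasSeq]
  linear_combination eq_mul_of_catalan hu hp hq

theorem lucasSeq_add_two_eq (hu : 1 + q ≠ 0) (hp : p * (1 + q) = -q)
    (hq : q + q ^ 2 = x * (1 + q + q ^ 2) ^ 2) (k : ℕ) :
    lucasSeq p q (k + 2) = x * (lucasSeq p q k + lucasSeq p q (k + 1) +
      lucasSeq p q (k + 3) + lucasSeq p q (k + 4)) := by
  simp only [lucasSeq]
  linear_combination lucasSeq p q (k + 1) * eq_mul_of_catalan hu hp hq +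
    lucasSeq p q k * neg_eq_mul_of_catalan hu hp hq

end Series

section Walks

theorem ht_concat_of_le (t : List ℤ) (d : ℤ) {i : ℕ} (h : i ≤ t.length) :
    ht (t ++ [d]) i = ht t i := by
  rw [ht, ht, List.take_append_of_le_length h]

theorem ht_concat_length (t : List ℤ) (d : ℤ) :
    ht (t ++ [d]) (t.length + 1) = ht t t.length + d := by
  simp [ht, List.take_of_length_le]

/-- The basketball walks of length `n` from `0` to `k` that are positive except at the origin. -/
def positiveWalks : ℕ → ℤ → Finset (List ℤ)
  | 0, k => if k = 0 then {[]} else ∅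
  | n + 1, k => if 0 < k then
      ({-2, -1, 1, 2} : Finset ℤ).biUnion fun d => (positiveWalks n (k - d)).image (· ++ [d])
    else ∅

theorem mem_positiveWalks (n : ℕ) (k : ℤ) (s : List ℤ) :
    s ∈ positiveWalks n k ↔ s.length = n ∧ IsBasketball s ∧ ht s s.length = k ∧
      ∀ i, 1 ≤ i → i ≤ s.length → 0 < ht s i := by
  induction n generalizing k s with
  | zero =>
    rw [positiveWalks, List.length_eq_zero_iff]
    constructor
    · intro h
      split_ifs at h with hk
      · obtain rfl : s = [] := by simpa using h
        simp only [List.length_nil]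
        exact ⟨trivial, by simp [IsBasketball], by simp [ht, hk], by omega⟩
      · simp at h
    · rintro ⟨rfl, -, h, -⟩
      have : k = 0 := by simpa [ht] using h.symm
      simp [this]
  | succ n ih =>
    rcases List.eq_nil_or_concat' s with rfl | ⟨t, d, rfl⟩
    · simp [positiveWalks]
      split_ifs <;> simp
    have hmem : t ++ [d] ∈ positiveWalks (n + 1) k ↔
        0 < k ∧ d ∈ ({-2, -1, 1, 2} : Finset ℤ) ∧ t ∈ positiveWalks n (k - d) := by
      rw [positiveWalks]
      split_ifs with hk
      · simp only [Finset.mem_biUnion, Finset.mem_image, hk, true_and]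
        constructor
        · rintro ⟨e, he, u, hu, h⟩
          obtain ⟨rfl, h⟩ := List.append_inj' h rfl
          obtain rfl : e = d := by simpa using h
          exact ⟨he, hu⟩
        · rintro ⟨hd, ht⟩
          exact ⟨d, hd, t, ht, rfl⟩
      · simp [hk]
    rw [hmem, ih]
    have hb : IsBasketball (t ++ [d]) ↔ d ∈ ({-2, -1, 1, 2} : Finset ℤ) ∧ IsBasketball t := by
      simp only [IsBasketball, List.mem_append, List.mem_singleton, Finset.mem_insert,
        Finset.mem_singleton]
      constructor
      · exact fun h => ⟨h d (Or.inr rfl), fun x hx => h x (Or.inl hx)⟩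
      · rintro ⟨h, h'⟩ x (hx | rfl)
        exacts [h' x hx, h]
    have hlen : (t ++ [d]).length = t.length + 1 := by simp
    rw [hb, hlen, ht_concat_length]
    constructor
    · rintro ⟨hk, hd, hn, hB, hh, hpos⟩
      refine ⟨by omega, ⟨hd, hB⟩, by omega, fun i hi hi' => ?_⟩
      rcases Nat.lt_or_ge t.length i with h | h
      · obtain rfl : i = t.length + 1 := by omega
        rw [ht_concat_length]; omega
      · rw [ht_concat_of_le t d h]; exact hpos i hi h
    · rintro ⟨hn, ⟨hd, hB⟩, hh, hpos⟩
      refine ⟨?_, hd, by omega, hB, by omega, fun i hi hi' => ?_⟩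
      · have := hpos (t.length + 1) (by omega) le_rfl
        rw [ht_concat_length] at this
        omega
      · rw [← ht_concat_of_le t d hi']; exact hpos i hi (by omega)

theorem card_positiveWalks_succ (n : ℕ) {k : ℤ} (hk : 0 < k) :
    (positiveWalks (n + 1) k).card = (positiveWalks n (k - 2)).card +
      (positiveWalks n (k - 1)).card + (positiveWalks n (k + 1)).card +
      (positiveWalks n (k + 2)).card := by
  rw [positiveWalks, if_pos hk, Finset.card_biUnion]
  · simp only [Finset.card_image_of_injective _ (List.append_left_injective _)]
    rw [Finset.sum_insert (by decide), Finset.sum_insert (by decide),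
      Finset.sum_insert (by decide), Finset.sum_singleton]
    simp only [sub_neg_eq_add]
    ring
  · intro d _ e _ hde
    rw [Function.onFun, Finset.disjoint_left]
    intro s hs hs'
    simp only [Finset.mem_image] at hs hs'
    obtain ⟨t, -, rfl⟩ := hs
    obtain ⟨u, -, h⟩ := hs'
    have := (List.append_inj' h rfl).2
    exact hde (by simpa using this.symm)

theorem positiveWalks_of_neg (n : ℕ) {k : ℤ} (hk : k < 0) : positiveWalks n k = ∅ := by
  cases n with
  | zero => rw [positiveWalks, if_neg hk.ne]
  | succ n => rw [positiveWalks, if_neg hk.le.not_gt]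

theorem gCount_eq_card (n : ℕ) : gCount n = (positiveWalks n 1).card := by
  rw [gCount, ← Nat.card_eq_finsetCard]
  refine Nat.card_congr (Equiv.subtypeEquivRight fun s => ?_)
  rw [mem_positiveWalks, IsGWalk, and_comm]

end Walks

open PowerSeries in
theorem coeff_lucasSeq_eq_card {p q : PowerSeries ℤ} (hq₀ : constantCoeff q = 0)
    (hp : p * (1 + q) = -q) (hq : q + q ^ 2 = X * (1 + q + q ^ 2) ^ 2) (n k : ℕ) :
    coeff n (lucasSeq p q k) = (positiveWalks n k).card := by
  have hu : 1 + q ≠ 0 := fun h => by simpa [hq₀] using congrArg constantCoeff h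
  induction n generalizing k with
  | zero =>
    match k with
    | 0 => simp [lucasSeq, positiveWalks]
    | 1 => simp [lucasSeq, positiveWalks, hq₀]
    | k + 2 =>
      rw [lucasSeq_add_two_eq hu hp hq, positiveWalks, if_neg (by omega)]
      simp
  | succ n ih =>
    match k with
    | 0 => simp [lucasSeq, positiveWalks, coeff_one]
    | 1 =>
      rw [lucasSeq_one_eq hu hp hq, coeff_succ_X_mul, Nat.cast_one,
        card_positiveWalks_succ n one_pos, positiveWalks_of_neg n (by norm_num)]
      simp [ih]
    | k + 2 =>
      rw [lucasSeq_add_two_eq hu hp hq, coeff_succ_X_mul, card_positiveWalks_succ n (by omega)]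
      simp only [map_add, ih]
      push_cast
      ring_nf

open PowerSeries in
theorem gCount_eq_catalanHalf (n : ℕ) : (gCount n : ℤ) = catalanHalf n := by
  have hq₀ : constantCoeff (mk catalanHalf) = 0 := by
    simp [← coeff_zero_eq_constantCoeff_apply, catalanHalf]
  have hq : mk catalanHalf + mk catalanHalf ^ 2 =
      X * (1 + mk catalanHalf + mk catalanHalf ^ 2) ^ 2 := by
    have h := mk_catalan_eq
    rw [← mk_catalanHalf_quadratic] at h
    linear_combination h
  obtain ⟨v, hv⟩ : ∃ v, v * (1 + mk catalanHalf) = 1 :=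
    (isUnit_iff_constantCoeff.2 (by simp [hq₀])).exists_left_inv
  have h := coeff_lucasSeq_eq_card (p := -mk catalanHalf * v) hq₀
    (by rw [mul_assoc, hv, mul_one]) hq n 1
  rw [gCount_eq_card, ← Nat.cast_one, ← h, lucasSeq, coeff_mk]

/-- The coefficient form of `1 + G + G² = C`: `catalan n = g_n + ∑_{i+j=n, i,j ≥ 1} g_i g_j`. -/
theorem stmt17 (n : ℕ) (hn : 1 ≤ n) :
    catalan n = gCount n + ∑ i ∈ Finset.Icc 1 (n - 1), gCount i * gCount (n - i) := by
  obtain ⟨n, rfl⟩ := Nat.exists_eq_succ_of_ne_zero (Nat.one_le_iff_ne_zero.1 hn)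
  have h := catalanHalf_succ n
  simp only [← gCount_eq_catalanHalf] at h
  rw [Nat.succ_eq_add_one, Nat.add_sub_cancel, ← Finset.Ico_add_one_right_eq_Icc,
    Finset.sum_Ico_eq_sum_range, Nat.add_sub_cancel]
  have h' : catalan (n + 1) = gCount (n + 1) +
      ∑ i ∈ Finset.range n, gCount (i + 1) * gCount (n - i) := by
    exact_mod_cast h.symm
  rw [h']
  congr 1
  refine Finset.sum_congr rfl fun i _ => ?_
  rw [add_comm 1 i, Nat.add_sub_add_right]
end

section
/- For integers d ≥ 1, ℓ ≥ 0 and r ≥ 0, the number of binary trees having exactly 2d double leaves, exactly ℓ left leaves and exactly r right leaves is equal to (1/d)·binomial(2d-2, d-1)·binomial(ℓ+r+2d-2, ℓ+r)·binomial(ℓ+r, ℓ). -/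
/-- Binary trees: every vertex has either 0 or 2 ordered children. -/
inductive FBTree where
  | leaf : FBTree
  | node : FBTree → FBTree → FBTree

/-- Number of leaves. -/
def FBTree.leaves : FBTree → ℕ
  | .leaf => 1
  | .node l r => l.leaves + r.leaves

/-- Number of double leaves: leaves whose sibling is also a leaf. -/
def FBTree.doubleLeaves : FBTree → ℕ
  | .leaf => 0
  | .node .leaf .leaf => 2
  | .node l r => l.doubleLeaves + r.doubleLeaves

/-- Number of left leaves: leaves that are left children and whose sibling is not a leaf. -/
def FBTree.leftLeaves : FBTree → ℕ
  | .leaf => 0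
  | .node .leaf .leaf => 0
  | .node .leaf r => 1 + r.leftLeaves
  | .node l .leaf => l.leftLeaves
  | .node l r => l.leftLeaves + r.leftLeaves

/-- Number of right leaves: leaves that are right children and whose sibling is not a leaf. -/
def FBTree.rightLeaves : FBTree → ℕ
  | .leaf => 0
  | .node .leaf .leaf => 0
  | .node .leaf r => r.rightLeaves
  | .node l .leaf => 1 + l.rightLeaves
  | .node l r => l.rightLeaves + r.rightLeaves

namespace FBTree

theorem doubleLeaves_node {t s : FBTree} (h : t ≠ leaf ∨ s ≠ leaf) :
    (node t s).doubleLeaves = t.doubleLeaves + s.doubleLeaves := by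
  cases t <;> cases s <;> simp_all [doubleLeaves]

theorem leftLeaves_leaf_node {t : FBTree} (h : t ≠ leaf) :
    (node leaf t).leftLeaves = 1 + t.leftLeaves := by
  cases t <;> simp_all [leftLeaves]

theorem leftLeaves_node {t : FBTree} (s : FBTree) (h : t ≠ leaf) :
    (node t s).leftLeaves = t.leftLeaves + s.leftLeaves := by
  cases t <;> cases s <;> simp_all [leftLeaves]

theorem rightLeaves_node_leaf {t : FBTree} (h : t ≠ leaf) :
    (node t leaf).rightLeaves = 1 + t.rightLeaves := by
  cases t <;> simp_all [rightLeaves]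

theorem rightLeaves_node (t : FBTree) {s : FBTree} (h : s ≠ leaf) :
    (node t s).rightLeaves = t.rightLeaves + s.rightLeaves := by
  cases t <;> cases s <;> simp_all [rightLeaves]

theorem two_le_doubleLeaves {t : FBTree} (h : t ≠ leaf) : 2 ≤ t.doubleLeaves := by
  induction t with
  | leaf => exact absurd rfl h
  | node t s iht ihs =>
    by_cases ht : t = leaf
    · by_cases hs : s = leaf
      · simp [ht, hs, doubleLeaves]
      · rw [doubleLeaves_node (.inr hs)]
        have := ihs hs
        omega
    · rw [doubleLeaves_node (.inl ht)]
      have := iht ht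
      omega

/-- Ordered forests of `k` trees other than single vertices, with `2 * (k + b)` double leaves,
`l` left leaves and `r` right leaves in total. -/
def forests (k b l r : ℕ) : Set (List FBTree) :=
  {f | f.length = k ∧ (∀ t ∈ f, t ≠ leaf) ∧ (f.map doubleLeaves).sum = 2 * (k + b) ∧
    (f.map leftLeaves).sum = l ∧ (f.map rightLeaves).sum = r}

/-- The number of forests in `FBTree.forests k b l r`, computed by removing the root of the
first tree. -/
def forestCount : ℕ → ℕ → ℕ → ℕ → ℕ
  | 0, b, l, r => if b = 0 ∧ l = 0 ∧ r = 0 then 1 else 0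
  | k + 1, b, l, r =>
    forestCount k b l r + (if 0 < b then forestCount (k + 2) (b - 1) l r else 0) +
      (if 0 < l then forestCount (k + 1) b (l - 1) r else 0) +
      (if 0 < r then forestCount (k + 1) b l (r - 1) else 0)
termination_by k b l r => k + 2 * b + l + r

open Nat in
theorem forestCount_succ_mul_factorial (k b l r : ℕ) :
    forestCount (k + 1) b l r * ((k + 1 + b)! * b ! * l ! * r !) =
      (k + 1) * (k + 2 * b + l + r)! := by
  induction hn : k + 2 * b + l + r generalizing k b l r with
  | zero =>
    obtain ⟨rfl, rfl, rfl, rfl⟩ : k = 0 ∧ b = 0 ∧ l = 0 ∧ r = 0 := by omega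
    simp [forestCount]
  | succ n ih =>
    have h1 : forestCount k b l r * ((k + b)! * b ! * l ! * r !) = k * n ! := by
      cases k with
      | zero =>
        rw [forestCount, if_neg (by omega)]
        simp
      | succ k => rw [ih k b l r (by omega)]
    have h2 : (if 0 < b then forestCount (k + 2) (b - 1) l r else 0) *
        ((k + 1 + b)! * b ! * l ! * r !) = b * ((k + 2) * n !) := by
      cases b with
      | zero => simp
      | succ b =>
        have := ih (k + 1) b l r (by omega)
        rw [if_pos b.succ_pos, Nat.add_sub_cancel, ← this, factorial_succ b,
          show k + 1 + (b + 1) = k + 1 + 1 + b by ring]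
        ring
    have h3 : (if 0 < l then forestCount (k + 1) b (l - 1) r else 0) *
        ((k + 1 + b)! * b ! * l ! * r !) = l * ((k + 1) * n !) := by
      cases l with
      | zero => simp
      | succ l =>
        rw [if_pos l.succ_pos, Nat.add_sub_cancel, ← ih k b l r (by omega), factorial_succ l]
        ring
    have h4 : (if 0 < r then forestCount (k + 1) b l (r - 1) else 0) *
        ((k + 1 + b)! * b ! * l ! * r !) = r * ((k + 1) * n !) := by
      cases r with
      | zero => simp
      | succ r =>
        rw [if_pos r.succ_pos, Nat.add_sub_cancel, ← ih k b l r (by omega), factorial_succ r]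
        ring
    have h5 : (k + 1 + b)! = (k + b + 1) * (k + b)! := by
      rw [← factorial_succ, Nat.add_right_comm]
    rw [forestCount, add_mul, add_mul, add_mul, h2, h3, h4, h5, factorial_succ, ← hn]
    linear_combination (k + b + 1) * h1

/-- Replace the first tree `t` of a forest by `node leaf t`. -/
def graftLeft : List FBTree → List FBTree
  | [] => []
  | t :: f => node leaf t :: f

/-- Replace the first tree `t` of a forest by `node t leaf`. -/
def graftRight : List FBTree → List FBTree
  | [] => []
  | t :: f => node t leaf :: f

/-- Replace the first two trees `t`, `s` of a forest by `node t s`. -/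
def merge : List FBTree → List FBTree
  | t :: s :: f => node t s :: f
  | f => f

theorem graftLeft_injective : Function.Injective graftLeft := by
  rintro (_ | ⟨t, f⟩) (_ | ⟨s, g⟩) h <;> simp_all [graftLeft]

theorem graftRight_injective : Function.Injective graftRight := by
  rintro (_ | ⟨t, f⟩) (_ | ⟨s, g⟩) h <;> simp_all [graftRight]

theorem merge_injOn (k b l r : ℕ) : Set.InjOn merge (forests (k + 2) b l r) := by
  rintro (_ | ⟨t, _ | ⟨s, f⟩⟩) hf (_ | ⟨t', _ | ⟨s', g⟩⟩) hg h <;>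
    simp_all [merge, forests]

theorem two_mul_length_le_sum_doubleLeaves {f : List FBTree} (h : ∀ t ∈ f, t ≠ leaf) :
    2 * f.length ≤ (f.map doubleLeaves).sum := by
  induction f with
  | nil => simp
  | cons t f ih =>
    have h1 := two_le_doubleLeaves (h t (by simp))
    have h2 := ih fun s hs => h s (by simp [hs])
    simp only [List.length_cons, List.map_cons, List.sum_cons]
    omega

theorem forests_zero (b l r : ℕ) :
    forests 0 b l r = if b = 0 ∧ l = 0 ∧ r = 0 then {[]} else ∅ := by
  ext f
  split_ifs with h
  · obtain ⟨rfl, rfl, rfl⟩ := h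
    cases f <;> simp [forests]
  · cases f with
    | nil =>
      simp [forests]
      omega
    | cons t f => simp [forests]

theorem cons_cherry_mem_forests {k b l r : ℕ} {f : List FBTree} :
    node leaf leaf :: f ∈ forests (k + 1) b l r ↔ f ∈ forests k b l r := by
  simp only [forests, Set.mem_ofPred_eq, List.length_cons, List.mem_cons, forall_eq_or_imp,
    List.map_cons, List.sum_cons, doubleLeaves, leftLeaves, rightLeaves, ne_eq, reduceCtorEq,
    not_false_eq_true, true_and, Nat.zero_add]
  refine and_congr (by omega) (and_congr_right fun _ => and_congr_left fun _ => by omega)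

theorem cons_leaf_node_mem_forests {k b l r : ℕ} {t : FBTree} {f : List FBTree} (ht : t ≠ leaf) :
    node leaf t :: f ∈ forests k b l r ↔ 0 < l ∧ t :: f ∈ forests k b (l - 1) r := by
  simp only [forests, Set.mem_ofPred_eq, List.length_cons, List.mem_cons, forall_eq_or_imp,
    List.map_cons, List.sum_cons, doubleLeaves_node (.inr ht), leftLeaves_leaf_node ht,
    rightLeaves_node _ ht, doubleLeaves, rightLeaves, ne_eq, reduceCtorEq,
    not_false_eq_true, true_and, Nat.zero_add, ht]
  grind

theorem cons_node_leaf_mem_forests {k b l r : ℕ} {t : FBTree} {f : List FBTree} (ht : t ≠ leaf) :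
    node t leaf :: f ∈ forests k b l r ↔ 0 < r ∧ t :: f ∈ forests k b l (r - 1) := by
  simp only [forests, Set.mem_ofPred_eq, List.length_cons, List.mem_cons, forall_eq_or_imp,
    List.map_cons, List.sum_cons, doubleLeaves_node (.inl ht), leftLeaves_node _ ht,
    rightLeaves_node_leaf ht, doubleLeaves, leftLeaves, ne_eq, reduceCtorEq,
    not_false_eq_true, true_and, Nat.add_zero, ht]
  grind

theorem cons_node_mem_forests {k b l r : ℕ} {t s : FBTree} {f : List FBTree}
    (ht : t ≠ leaf) (hs : s ≠ leaf) :
    node t s :: f ∈ forests (k + 1) b l r ↔ 0 < b ∧ t :: s :: f ∈ forests (k + 2) (b - 1) l r := by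
  have h1 := two_le_doubleLeaves ht
  have h2 := two_le_doubleLeaves hs
  have h3 := two_mul_length_le_sum_doubleLeaves (f := f)
  simp only [forests, Set.mem_ofPred_eq, List.length_cons, List.mem_cons, forall_eq_or_imp,
    List.map_cons, List.sum_cons, doubleLeaves_node (.inl ht), leftLeaves_node _ ht,
    rightLeaves_node _ hs, ne_eq, reduceCtorEq, not_false_eq_true, true_and, ht, hs]
  grind

theorem forests_succ (k b l r : ℕ) :
    forests (k + 1) b l r =
      List.cons (node leaf leaf) '' forests k b l r ∪
        merge '' (if 0 < b then forests (k + 2) (b - 1) l r else ∅) ∪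
        graftLeft '' (if 0 < l then forests (k + 1) b (l - 1) r else ∅) ∪
        graftRight '' (if 0 < r then forests (k + 1) b l (r - 1) else ∅) := by
  ext f
  simp only [Set.mem_union, Set.mem_image, Set.mem_ite_empty_right]
  constructor
  · intro hf
    match f, hf with
    | [], hf => simp [forests] at hf
    | leaf :: f, hf => simp [forests] at hf
    | node t s :: f, hf =>
      by_cases ht : t = leaf <;> by_cases hs : s = leaf
      · subst ht hs
        exact .inl (.inl (.inl ⟨f, cons_cherry_mem_forests.1 hf, rfl⟩))
      · subst ht
        exact .inl (.inr ⟨s :: f, (cons_leaf_node_mem_forests hs).1 hf, rfl⟩)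
      · subst hs
        exact .inr ⟨t :: f, (cons_node_leaf_mem_forests ht).1 hf, rfl⟩
      · exact .inl (.inl (.inr ⟨t :: s :: f, (cons_node_mem_forests ht hs).1 hf, rfl⟩))
  · rintro (((⟨g, hg, rfl⟩ | ⟨g, hg, rfl⟩) | ⟨g, hg, rfl⟩) | ⟨g, hg, rfl⟩)
    · exact cons_cherry_mem_forests.2 hg
    · match g, hg with
      | [], hg => simp [forests] at hg
      | [t], hg => simp [forests] at hg
      | t :: s :: g, hg =>
        exact (cons_node_mem_forests (hg.2.2.1 t (by simp)) (hg.2.2.1 s (by simp))).2 hg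
    · match g, hg with
      | [], hg => simp [forests] at hg
      | t :: g, hg => exact (cons_leaf_node_mem_forests (hg.2.2.1 t (by simp))).2 hg
    · match g, hg with
      | [], hg => simp [forests] at hg
      | t :: g, hg => exact (cons_node_leaf_mem_forests (hg.2.2.1 t (by simp))).2 hg

theorem exists_cons_cons_of_mem_forests {k b l r : ℕ} {f : List FBTree}
    (hf : f ∈ forests (k + 2) b l r) :
    ∃ t s g, f = t :: s :: g ∧ t ≠ leaf ∧ s ≠ leaf := by
  match f, hf with
  | [], hf => simp [forests] at hf
  | [t], hf => simp [forests] at hf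
  | t :: s :: g, hf => exact ⟨t, s, g, rfl, hf.2.1 t (by simp), hf.2.1 s (by simp)⟩

theorem exists_cons_of_mem_forests {k b l r : ℕ} {f : List FBTree}
    (hf : f ∈ forests (k + 1) b l r) : ∃ t g, f = t :: g ∧ t ≠ leaf := by
  match f, hf with
  | [], hf => simp [forests] at hf
  | t :: g, hf => exact ⟨t, g, rfl, hf.2.1 t (by simp)⟩

theorem encard_forests (k b l r : ℕ) : (forests k b l r).encard = forestCount k b l r := by
  induction k, b, l, r using forestCount.induct with
  | case1 b l r h => simp [forests_zero, forestCount, h]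
  | case2 b l r h => simp [forests_zero, forestCount, h]
  | case3 k b l r h1 h2 h3 h4 =>
    rw [forests_succ, Set.encard_union_eq, Set.encard_union_eq, Set.encard_union_eq,
      List.cons_injective.encard_image, Set.InjOn.encard_image, graftLeft_injective.encard_image,
      graftRight_injective.encard_image, forestCount]
    · push_cast
      congr 1
      · congr 1
        · congr 1
          split_ifs with h
          · exact h2 h
          · simp
        · split_ifs with h
          · exact h3 h
          · simp
      · split_ifs with h
        · exact h4 h
        · simp
    · split_ifs
      · exact merge_injOn ..
      · simp
    all_goals
      rw [Set.disjoint_left]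
      simp only [Set.mem_union, Set.mem_image, Set.mem_ite_empty_right, not_exists, not_and]
    · rintro _ ⟨g, hg, rfl⟩ f ⟨-, hf⟩
      obtain ⟨t, s, f, rfl, ht, hs⟩ := exists_cons_cons_of_mem_forests hf
      simp [merge, ht]
    · rintro _ (⟨g, hg, rfl⟩ | ⟨g, ⟨-, hg⟩, rfl⟩) f ⟨-, hf⟩
      · obtain ⟨t, f, rfl, ht⟩ := exists_cons_of_mem_forests hf
        simp [graftLeft, ht]
      · obtain ⟨t, f, rfl, ht⟩ := exists_cons_of_mem_forests hf
        obtain ⟨t', s, g, rfl, ht', hs⟩ := exists_cons_cons_of_mem_forests hg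
        simp [graftLeft, merge, ht'.symm]
    · rintro _ ((⟨g, hg, rfl⟩ | ⟨g, ⟨-, hg⟩, rfl⟩) | ⟨g, ⟨-, hg⟩, rfl⟩) f ⟨-, hf⟩
      · obtain ⟨t, f, rfl, ht⟩ := exists_cons_of_mem_forests hf
        simp [graftRight, ht]
      · obtain ⟨t, f, rfl, ht⟩ := exists_cons_of_mem_forests hf
        obtain ⟨t', s, g, rfl, ht', hs⟩ := exists_cons_cons_of_mem_forests hg
        simp [graftRight, merge, hs.symm]
      · obtain ⟨t, f, rfl, ht⟩ := exists_cons_of_mem_forests hf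
        obtain ⟨t', g, rfl, ht'⟩ := exists_cons_of_mem_forests hg
        simp [graftLeft, graftRight, ht]

theorem card_eq_forestCount (b l r : ℕ) :
    Nat.card {t : FBTree //
      t.doubleLeaves = 2 * (b + 1) ∧ t.leftLeaves = l ∧ t.rightLeaves = r} =
      forestCount 1 b l r := by
  have h : forests 1 b l r = (fun t => [t]) '' {t : FBTree |
      t.doubleLeaves = 2 * (b + 1) ∧ t.leftLeaves = l ∧ t.rightLeaves = r} := by
    ext f
    constructor
    · intro hf
      obtain ⟨t, rfl⟩ := List.length_eq_one_iff.1 hf.1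
      exact ⟨t, by simpa [Nat.add_comm] using hf.2.2, rfl⟩
    · rintro ⟨t, ht, rfl⟩
      refine ⟨rfl, ?_, by simpa [Nat.add_comm] using ht⟩
      simp only [List.mem_singleton, forall_eq]
      rintro rfl
      simp [doubleLeaves] at ht
  have h' := encard_forests 1 b l r
  rw [h, Function.Injective.encard_image fun _ _ => by simp] at h'
  refine (Nat.card_coe_set_eq {t : FBTree |
    t.doubleLeaves = 2 * (b + 1) ∧ t.leftLeaves = l ∧ t.rightLeaves = r}).trans ?_
  rw [Set.ncard_def, h', ENat.toNat_natCast]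

end FBTree

/-- Count of binary trees with `2d` double leaves, `l` left leaves and `r` right leaves. -/
theorem stmt18 (d l r : ℕ) (hd : 1 ≤ d) :
    d * Nat.card {t : FBTree //
        t.doubleLeaves = 2 * d ∧ t.leftLeaves = l ∧ t.rightLeaves = r} =
      Nat.choose (2 * d - 2) (d - 1) * Nat.choose (l + r + 2 * d - 2) (l + r) *
        Nat.choose (l + r) l := by
  obtain ⟨b, rfl⟩ : ∃ b, d = b + 1 := ⟨d - 1, by omega⟩
  rw [FBTree.card_eq_forestCount, show 2 * (b + 1) - 2 = b + b by omega, Nat.add_sub_cancel,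
    show l + r + 2 * (b + 1) - 2 = l + r + (b + b) by omega]
  have h := FBTree.forestCount_succ_mul_factorial 0 b l r
  have h1 := Nat.add_choose_mul_factorial_mul_factorial b b
  have h2 := Nat.add_choose_mul_factorial_mul_factorial (l + r) (b + b)
  have h3 := Nat.add_choose_mul_factorial_mul_factorial l r
  rw [show 0 + 1 + b = b + 1 by omega, Nat.factorial_succ,
    show 0 + 2 * b + l + r = l + r + (b + b) by omega, ← h2, ← h1, ← h3] at h
  rw [← Nat.choose_symm_add (a := l + r), ← Nat.choose_symm_add (a := l)] at h
  have hpos : 0 < b.factorial * b.factorial * l.factorial * r.factorial := by positivity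
  refine Nat.eq_of_mul_eq_mul_right hpos ?_
  linear_combination h
end
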